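/- arXiv:1202.1217 — 3 statements merged into one kernel-verified Lean document; each statement's English description precedes it below -/
import Mathlib

section
/- Let ν > 0 and ε ∈ ℝ with |ε| ≤ 1. Let w : ℝ × [0,∞) → ℂ be twice continuously differentiable and f : ℝ²₊ → ℂ be such that: (i) Δw − iε w = f in ℝ²₊; (ii) −∂_{x₂}w(x₁,0) = ν w(x₁,0) for every x₁ ∈ ℝ; (iii) for every x₁ ∈ ℝ the function x₂ ↦ w(x₁,x₂)e^{−νx₂} is integrable on (0,∞) with ∫₀^∞ w(x₁,x₂)e^{−νx₂} dx₂ = 0; (iv) the integrals ∫_{ℝ²₊} (1+x₂)^{−2}|w|² dx, ∫_{ℝ²₊} |∇w|² dx, ∫_{ℝ²₊} Σ_{|δ|=2} |∂^δ w|² dx, ∫_ℝ |w(x₁,0)|² dx₁, and ∫_{ℝ²₊} (1+x₂)²|f|² dx are all finite. Then there is an absolute constant c, independent of ε, ν, w, f, such that ∫_{ℝ²₊} Σ_{|δ|=2} |∂^δ w|² dx + ∫_{ℝ²₊} (1+x₂)^{−2}|w|² dx ≤ c · ((1+ν²)/ν²) · ∫_{ℝ²₊} (1+x₂)²|f|²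 dx. -/
open Set MeasureTheory

/-- First partial derivative of a function on the closed half-plane `ℝ × [0,∞)`. -/
noncomputable def pd1 (f : ℝ × ℝ → ℂ) (q : ℝ × ℝ) : ℂ :=
  deriv (fun s : ℝ => f (s, q.2)) q.1

/-- Second partial derivative (one-sided at the boundary) of a function on `ℝ × [0,∞)`. -/
noncomputable def pd2 (f : ℝ × ℝ → ℂ) (q : ℝ × ℝ) : ℂ :=
  derivWithin (fun t : ℝ => f (q.1, t)) (Ici (0 : ℝ)) q.2

/-- The open upper half-plane `ℝ²₊ = {x₂ > 0}`. -/
def upperHalf : Set (ℝ × ℝ) := {p : ℝ × ℝ | 0 < p.2}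

/-- The closed upper half-plane. -/
def closedHalf : Set (ℝ × ℝ) := {p : ℝ × ℝ | 0 ≤ p.2}

lemma upperHalf_subset_closedHalf : upperHalf ⊆ closedHalf := fun p hp =>
  (show (0 : ℝ) < p.2 from hp).le

lemma closedHalf_eq_prod : closedHalf = univ ×ˢ Ici (0 : ℝ) := by
  ext p; simp [closedHalf]

lemma upperHalf_eq_prod : upperHalf = univ ×ˢ Ioi (0 : ℝ) := by
  ext p; simp [upperHalf]

lemma isOpen_upperHalf : IsOpen upperHalf := isOpen_lt continuous_const continuous_snd

lemma measurableSet_upperHalf : MeasurableSet upperHalf := isOpen_upperHalf.measurableSet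

lemma uniqueDiffOn_closedHalf : UniqueDiffOn ℝ closedHalf := by
  rw [closedHalf_eq_prod]
  exact uniqueDiffOn_univ.prod (uniqueDiffOn_Ici 0)

lemma volume_restrict_upperHalf :
    (volume : Measure (ℝ × ℝ)).restrict upperHalf
      = (volume : Measure ℝ).prod (volume.restrict (Ioi (0 : ℝ))) := by
  rw [upperHalf_eq_prod, Measure.volume_eq_prod, ← Measure.prod_restrict, Measure.restrict_univ]

lemma closedHalf_mem_nhds {p : ℝ × ℝ} (hp : p ∈ upperHalf) : closedHalf ∈ nhds p :=
  Filter.mem_of_superset (isOpen_upperHalf.mem_nhds hp) upperHalf_subset_closedHalf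

lemma hasDerivAt_fst_slice {w : ℝ × ℝ → ℂ} (hw : DifferentiableOn ℝ w closedHalf) {p : ℝ × ℝ}
    (hp : p ∈ closedHalf) :
    HasDerivAt (fun s : ℝ => w (s, p.2)) (fderivWithin ℝ w closedHalf p (1, 0)) p.1 := by
  have h1 : HasFDerivWithinAt w (fderivWithin ℝ w closedHalf p) closedHalf ((fun s : ℝ => (s, p.2)) p.1) :=
    (hw p hp).hasFDerivWithinAt
  have h2 : HasDerivWithinAt (fun s : ℝ => (s, p.2)) ((1 : ℝ), (0 : ℝ)) univ p.1 :=
    ((hasDerivAt_id p.1).prodMk (hasDerivAt_const p.1 p.2)).hasDerivWithinAt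
  have h3 := h1.comp_hasDerivWithinAt (t := closedHalf) p.1 h2 (fun s _ => hp)
  exact (hasDerivWithinAt_univ.1 h3)

lemma hasDerivWithinAt_snd_slice {w : ℝ × ℝ → ℂ} (hw : DifferentiableOn ℝ w closedHalf)
    {p : ℝ × ℝ} (hp : p ∈ closedHalf) :
    HasDerivWithinAt (fun t : ℝ => w (p.1, t)) (fderivWithin ℝ w closedHalf p (0, 1)) (Ici 0)
      p.2 := by
  have h1 : HasFDerivWithinAt w (fderivWithin ℝ w closedHalf p) closedHalf ((fun t : ℝ => (p.1, t)) p.2) :=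
    (hw p hp).hasFDerivWithinAt
  have h2 : HasDerivWithinAt (fun t : ℝ => (p.1, t)) ((0 : ℝ), (1 : ℝ)) (Ici 0) p.2 :=
    ((hasDerivAt_const p.2 p.1).prodMk (hasDerivAt_id p.2)).hasDerivWithinAt
  exact h1.comp_hasDerivWithinAt (t := closedHalf) p.2 h2 (fun s hs => hs)

lemma pd1_eq_fderivWithin {w : ℝ × ℝ → ℂ} (hw : DifferentiableOn ℝ w closedHalf) {p : ℝ × ℝ}
    (hp : p ∈ closedHalf) : pd1 w p = fderivWithin ℝ w closedHalf p (1, 0) :=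
  (hasDerivAt_fst_slice hw hp).deriv

lemma pd2_eq_fderivWithin {w : ℝ × ℝ → ℂ} (hw : DifferentiableOn ℝ w closedHalf) {p : ℝ × ℝ}
    (hp : p ∈ closedHalf) : pd2 w p = fderivWithin ℝ w closedHalf p (0, 1) :=
  (hasDerivWithinAt_snd_slice hw hp).derivWithin (uniqueDiffOn_Ici 0 p.2 hp)

lemma hasDerivAt_pd1 {w : ℝ × ℝ → ℂ} (hw : DifferentiableOn ℝ w closedHalf) {p : ℝ × ℝ}
    (hp : p ∈ closedHalf) : HasDerivAt (fun s : ℝ => w (s, p.2)) (pd1 w p) p.1 :=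
  pd1_eq_fderivWithin hw hp ▸ hasDerivAt_fst_slice hw hp

lemma hasDerivWithinAt_pd2 {w : ℝ × ℝ → ℂ} (hw : DifferentiableOn ℝ w closedHalf) {p : ℝ × ℝ}
    (hp : p ∈ closedHalf) :
    HasDerivWithinAt (fun t : ℝ => w (p.1, t)) (pd2 w p) (Ici 0) p.2 :=
  pd2_eq_fderivWithin hw hp ▸ hasDerivWithinAt_snd_slice hw hp

lemma hasDerivAt_pd2 {w : ℝ × ℝ → ℂ} (hw : DifferentiableOn ℝ w closedHalf) {p : ℝ × ℝ}
    (hp : p ∈ upperHalf) : HasDerivAt (fun t : ℝ => w (p.1, t)) (pd2 w p) p.2 :=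
  (hasDerivWithinAt_pd2 hw (upperHalf_subset_closedHalf hp)).hasDerivAt (Ici_mem_nhds hp)

lemma contDiffOn_pd1 {w : ℝ × ℝ → ℂ} {m n : WithTop ℕ∞} (hw : ContDiffOn ℝ n w closedHalf)
    (hmn : m + 1 ≤ n) : ContDiffOn ℝ m (pd1 w) closedHalf := by
  have hd : DifferentiableOn ℝ w closedHalf :=
    (hw.of_le ((le_add_self).trans hmn)).differentiableOn one_ne_zero
  exact ((hw.fderivWithin uniqueDiffOn_closedHalf hmn).clm_apply contDiffOn_const).congr
    fun p hp => pd1_eq_fderivWithin hd hp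

lemma contDiffOn_pd2 {w : ℝ × ℝ → ℂ} {m n : WithTop ℕ∞} (hw : ContDiffOn ℝ n w closedHalf)
    (hmn : m + 1 ≤ n) : ContDiffOn ℝ m (pd2 w) closedHalf := by
  have hd : DifferentiableOn ℝ w closedHalf :=
    (hw.of_le ((le_add_self).trans hmn)).differentiableOn one_ne_zero
  exact ((hw.fderivWithin uniqueDiffOn_closedHalf hmn).clm_apply contDiffOn_const).congr
    fun p hp => pd2_eq_fderivWithin hd hp

/-- Trace inequality for a function on the half-line orthogonal to `e^{-νt}`. -/
lemma trace_sq_le_of_orthogonal {ν : ℝ} (hν : 0 < ν) {u u' : ℝ → ℂ}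
    (hcont : ContinuousWithinAt u (Ici 0) 0)
    (hderiv : ∀ t ∈ Ioi (0 : ℝ), HasDerivAt u (u' t) t)
    (hmeas : AEStronglyMeasurable u' (volume.restrict (Ioi (0 : ℝ))))
    (hu' : IntegrableOn (fun t => ‖u' t‖ ^ 2) (Ioi (0 : ℝ)))
    (hint : IntegrableOn (fun t : ℝ => u t * Complex.exp (-(ν : ℂ) * t)) (Ioi (0 : ℝ)))
    (horth : ∫ t in Ioi (0 : ℝ), u t * Complex.exp (-(ν : ℂ) * t) = 0) :
    2 * ν * ‖u 0‖ ^ 2 ≤ ∫ t in Ioi (0 : ℝ), ‖u' t‖ ^ 2 := by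
  have hexpn : ∀ t : ℝ, ‖Complex.exp (-(ν : ℂ) * t)‖ = Real.exp (-ν * t) := by
    intro t
    rw [Complex.norm_exp]; simp
  have hexp2 : ∀ t : ℝ, Real.exp (-ν * t) ^ 2 = Real.exp (-(2 * ν) * t) := by
    intro t; rw [← Real.exp_nat_mul]; congr 1; push_cast; ring
  have hE2 : IntegrableOn (fun t : ℝ => Real.exp (-ν * t) ^ 2) (Ioi (0 : ℝ)) := by
    simp_rw [hexp2]
    exact integrableOn_exp_mul_Ioi (by linarith) 0
  have hE2v : ∫ t in Ioi (0 : ℝ), Real.exp (-ν * t) ^ 2 = 1 / (2 * ν) := by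
    simp_rw [hexp2]
    rw [integral_exp_mul_Ioi (by linarith) 0]; simp
  have hd : ∀ t : ℝ, HasDerivAt (fun t : ℝ => Complex.exp (-(ν : ℂ) * t))
      (Complex.exp (-(ν : ℂ) * t) * -(ν : ℂ)) t := by
    intro t
    have := ((Complex.ofRealCLM.hasDerivAt (x := t)).const_mul (-(ν : ℂ))).cexp
    simpa using this
  have hmeasE : AEStronglyMeasurable (fun t : ℝ => Complex.exp (-(ν : ℂ) * t))
      (volume.restrict (Ioi (0 : ℝ))) :=
    (Continuous.aestronglyMeasurable (by fun_prop))
  have hu'E : IntegrableOn (fun t : ℝ => u' t * Complex.exp (-(ν : ℂ) * t)) (Ioi (0 : ℝ)) := by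
    refine (hu'.add hE2).mono' (hmeas.mul hmeasE) (Filter.Eventually.of_forall fun t => ?_)
    simp only [norm_mul, hexpn, Pi.add_apply]
    nlinarith [sq_nonneg (‖u' t‖ - Real.exp (-ν * t)), sq_nonneg ‖u' t‖,
      sq_nonneg (Real.exp (-ν * t))]
  have hdp : ∀ t ∈ Ioi (0 : ℝ), HasDerivAt (fun t : ℝ => u t * Complex.exp (-(ν : ℂ) * t))
      (u' t * Complex.exp (-(ν : ℂ) * t) + (-(ν : ℂ)) * (u t * Complex.exp (-(ν : ℂ) * t))) t := by
    intro t ht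
    exact ((hderiv t ht).mul (hd t)).congr_deriv (by ring)
  have hdint := hu'E.add (hint.const_mul (-(ν : ℂ)))
  have hlim := tendsto_zero_of_hasDerivAt_of_integrableOn_Ioi hdp hdint hint
  have hI := integral_Ioi_of_hasDerivAt_of_tendsto
    (hcont.mul (Continuous.continuousWithinAt (by fun_prop))) hdp hdint hlim
  rw [integral_add hu'E (hint.const_mul (-(ν : ℂ))), integral_const_mul, horth] at hI
  replace hI : ∫ t in Ioi (0 : ℝ), u' t * Complex.exp (-(ν : ℂ) * t) = -u 0 := by simpa using hI
  set a := ‖u 0‖ with ha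
  set J := ∫ t in Ioi (0 : ℝ), ‖u' t‖ ^ 2 with hJ
  have hJ0 : 0 ≤ J := integral_nonneg fun t => by positivity
  rcases (norm_nonneg (u 0)).eq_or_lt with h0 | h0
  · rw [ha, ← h0]; simpa using hJ0
  have hτ : 0 < 2 * ν * a := by positivity
  have key : a ≤ ∫ t in Ioi (0 : ℝ),
      ((2 * ν * a) / 2 * Real.exp (-ν * t) ^ 2 + 1 / (2 * (2 * ν * a)) * ‖u' t‖ ^ 2) := by
    have : a = ‖∫ t in Ioi (0 : ℝ), u' t * Complex.exp (-(ν : ℂ) * t)‖ := by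
      rw [hI, norm_neg]
    rw [this]
    refine norm_integral_le_of_norm_le ((hE2.const_mul _).add (hu'.const_mul _))
      (Filter.Eventually.of_forall fun t => ?_)
    rw [norm_mul, hexpn]
    rw [← this]
    set b := 2 * ν * a
    have : b / 2 * Real.exp (-ν * t) ^ 2 + 1 / (2 * b) * ‖u' t‖ ^ 2
      - ‖u' t‖ * Real.exp (-ν * t) = (b * Real.exp (-ν * t) - ‖u' t‖) ^ 2 / (2 * b) := by
      field_simp; ring
    have : 0 ≤ (b * Real.exp (-ν * t) - ‖u' t‖) ^ 2 / (2 * b) := by positivity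
    linarith
  rw [integral_add (hE2.const_mul _) (hu'.const_mul _), integral_const_mul, integral_const_mul,
    hE2v, ← hJ] at key
  have e1 : 2 * ν * a / 2 * (1 / (2 * ν)) = a / 2 := by field_simp
  rw [e1] at key
  have : a / 2 ≤ 1 / (2 * (2 * ν * a)) * J := by linarith
  have h4 : 1 / (2 * (2 * ν * a)) * J * (4 * ν * a) = J := by
    have ha0 : a ≠ 0 := h0.ne'
    field_simp
    ring
  have := mul_le_mul_of_nonneg_right this (show 0 ≤ 4 * ν * a by positivity)
  rw [h4] at this
  nlinarith

/-- Hardy's inequality on the half-line with weight `(1 + t)⁻²`. -/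
lemma hardy_half_line {u u' : ℝ → ℂ}
    (hcont : ContinuousOn u (Ici 0))
    (hderiv : ∀ t ∈ Ioi (0 : ℝ), HasDerivAt u (u' t) t)
    (hu : IntegrableOn (fun t => ((1 + t) ^ 2)⁻¹ * ‖u t‖ ^ 2) (Ioi (0 : ℝ)))
    (hu' : IntegrableOn (fun t => ‖u' t‖ ^ 2) (Ioi (0 : ℝ))) :
    ∫ t in Ioi (0 : ℝ), ((1 + t) ^ 2)⁻¹ * ‖u t‖ ^ 2 ≤
      2 * ‖u 0‖ ^ 2 + 4 * ∫ t in Ioi (0 : ℝ), ‖u' t‖ ^ 2 := by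
  have key : ∀ T : ℝ, 0 ≤ T → ∫ t in (0 : ℝ)..T, ((1 + t) ^ 2)⁻¹ * ‖u t‖ ^ 2 ≤
      2 * ‖u 0‖ ^ 2 + 4 * ∫ t in Ioi (0 : ℝ), ‖u' t‖ ^ 2 := by
    intro T hT
    have hsub : Icc 0 T ⊆ Ici (0 : ℝ) := Icc_subset_Ici_self
    have hII : IntervalIntegrable (fun t => ((1 + t) ^ 2)⁻¹ * ‖u t‖ ^ 2) volume 0 T :=
      (intervalIntegrable_iff_integrableOn_Ioc_of_le hT).2 (hu.mono_set Ioc_subset_Ioi_self)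
    have hII' : IntervalIntegrable (fun t => ‖u' t‖ ^ 2) volume 0 T :=
      (intervalIntegrable_iff_integrableOn_Ioc_of_le hT).2 (hu'.mono_set Ioc_subset_Ioi_self)
    have hc1 : ContinuousOn (fun t : ℝ => (1 + t)⁻¹) (Icc 0 T) :=
      ContinuousOn.inv₀ (by fun_prop) fun t ht => by have := ht.1; positivity
    have hg : ∀ t ∈ Ioo 0 T, HasDerivAt (fun t => (1 + t)⁻¹ * ‖u t‖ ^ 2)
        (-1 / (1 + t) ^ 2 * ‖u t‖ ^ 2 + (1 + t)⁻¹ * (2 * inner ℝ (u t) (u' t))) t := by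
      intro t ht
      have ht0 : (1 + t) ≠ 0 := by have := ht.1; positivity
      have h1 : HasDerivAt (fun t : ℝ => (1 + t)⁻¹) (-1 / (1 + t) ^ 2) t :=
        ((hasDerivAt_id t).const_add 1).inv ht0
      exact h1.mul (hderiv t ht.1).norm_sq
    have hle := intervalIntegral.sub_le_integral_of_hasDeriv_right_of_le (a := 0) (b := T)
      (φ := fun t => 2 * ‖u' t‖ ^ 2 - 1 / 2 * (((1 + t) ^ 2)⁻¹ * ‖u t‖ ^ 2)) hT
      (hc1.mul ((hcont.mono hsub).norm.pow 2))
      (fun t ht => (hg t ht).hasDerivWithinAt)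
      ((integrableOn_Icc_iff_integrableOn_Ioc (by simp)).2
        ((intervalIntegrable_iff_integrableOn_Ioc_of_le hT).1
          ((hII'.const_mul 2).sub (hII.const_mul (1 / 2))))) ?_
    · rw [intervalIntegral.integral_sub (hII'.const_mul 2) (hII.const_mul (1 / 2)),
        intervalIntegral.integral_const_mul, intervalIntegral.integral_const_mul] at hle
      have h1 : 0 ≤ (1 + T)⁻¹ * ‖u T‖ ^ 2 := by positivity
      have h2 : ∫ t in (0 : ℝ)..T, ‖u' t‖ ^ 2 ≤ ∫ t in Ioi (0 : ℝ), ‖u' t‖ ^ 2 := by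
        rw [intervalIntegral.integral_of_le hT]
        exact setIntegral_mono_set hu' (Filter.Eventually.of_forall fun t => by positivity)
          Ioc_subset_Ioi_self.eventuallyLE
      norm_num at hle
      linarith
    · intro t ht
      have h0 : 0 < 1 + t := by have := ht.1; positivity
      have := real_inner_le_norm (u t) (u' t)
      have h2 : (1 + t)⁻¹ * (2 * inner ℝ (u t) (u' t)) ≤ (1 + t)⁻¹ * (2 * (‖u t‖ * ‖u' t‖)) := by
        gcongr
      have h3 : -1 / (1 + t) ^ 2 * ‖u t‖ ^ 2 = - ((1 + t)⁻¹ * ‖u t‖) ^ 2 := by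
        field_simp
      have h4 : ((1 + t) ^ 2)⁻¹ * ‖u t‖ ^ 2 = ((1 + t)⁻¹ * ‖u t‖) ^ 2 := by
        field_simp
      rw [h3, h4]
      nlinarith [sq_nonneg ((1 + t)⁻¹ * ‖u t‖ - 2 * ‖u' t‖)]
  exact le_of_tendsto (intervalIntegral_tendsto_integral_Ioi 0 hu Filter.tendsto_id)
    ((Filter.eventually_ge_atTop 0).mono key)

/-- Admissible solutions of `Δw - iεw = f` with Robin boundary condition, orthogonal to
`e^{-νx₂}` on each fibre and of finite energy. -/
structure IsEnergySolution (ν ε : ℝ) (w f : ℝ × ℝ → ℂ) : Prop where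
  contDiffOn : ContDiffOn ℝ 2 w closedHalf
  equation : ∀ p ∈ upperHalf, pd1 (pd1 w) p + pd2 (pd2 w) p - Complex.I * ε * w p = f p
  robin : ∀ x₁ : ℝ, -pd2 w (x₁, 0) = ν * w (x₁, 0)
  orthogonal : ∀ x₁ : ℝ,
    IntegrableOn (fun t : ℝ => w (x₁, t) * Complex.exp (-(ν : ℂ) * t)) (Ioi (0 : ℝ)) ∧
      ∫ t in Ioi (0 : ℝ), w (x₁, t) * Complex.exp (-(ν : ℂ) * t) = 0
  integrable_weight : IntegrableOn (fun p : ℝ × ℝ => ((1 + p.2) ^ 2)⁻¹ * ‖w p‖ ^ 2) upperHalf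
  integrable_pd1 : IntegrableOn (fun p : ℝ × ℝ => ‖pd1 w p‖ ^ 2) upperHalf
  integrable_pd2 : IntegrableOn (fun p : ℝ × ℝ => ‖pd2 w p‖ ^ 2) upperHalf
  integrable_trace : Integrable (fun x₁ : ℝ => ‖w (x₁, 0)‖ ^ 2)
  integrable_source : IntegrableOn (fun p : ℝ × ℝ => (1 + p.2) ^ 2 * ‖f p‖ ^ 2) upperHalf
  integrable_absorption : IntegrableOn (fun p : ℝ × ℝ => ε * ‖w p‖ ^ 2) upperHalf

namespace IsEnergySolution

variable {ν ε : ℝ} {w f : ℝ × ℝ → ℂ}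

lemma differentiableOn (h : IsEnergySolution ν ε w f) : DifferentiableOn ℝ w closedHalf :=
  h.contDiffOn.differentiableOn two_ne_zero

lemma contDiffOn_pd1 (h : IsEnergySolution ν ε w f) : ContDiffOn ℝ 1 (pd1 w) closedHalf :=
  _root_.contDiffOn_pd1 h.contDiffOn (by norm_num)

lemma contDiffOn_pd2 (h : IsEnergySolution ν ε w f) : ContDiffOn ℝ 1 (pd2 w) closedHalf :=
  _root_.contDiffOn_pd2 h.contDiffOn (by norm_num)

lemma continuousOn_source (h : IsEnergySolution ν ε w f) : ContinuousOn f upperHalf := by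
  have h1 : ContinuousOn (pd1 (pd1 w)) closedHalf :=
    (_root_.contDiffOn_pd1 (m := 0) h.contDiffOn_pd1 (by norm_num)).continuousOn
  have h2 : ContinuousOn (pd2 (pd2 w)) closedHalf :=
    (_root_.contDiffOn_pd2 (m := 0) h.contDiffOn_pd2 (by norm_num)).continuousOn
  have h3 := (h1.add h2).sub (h.contDiffOn.continuousOn.const_smul (Complex.I * ε))
  exact (h3.mono upperHalf_subset_closedHalf).congr fun p hp => (h.equation p hp).symm

lemma continuousOn_snd_slice {g : ℝ × ℝ → ℂ} (hg : ContinuousOn g closedHalf) (x : ℝ) :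
    ContinuousOn (fun t => g (x, t)) (Ici 0) :=
  hg.comp (by fun_prop) fun _ ht => ht

lemma trace_le (h : IsEnergySolution ν ε w f) (hν : 0 < ν) :
    2 * ν * ∫ x, ‖w (x, 0)‖ ^ 2 ≤ ∫ p in upperHalf, ‖pd2 w p‖ ^ 2 := by
  have hi := h.integrable_pd2
  rw [IntegrableOn, volume_restrict_upperHalf] at hi
  rw [volume_restrict_upperHalf, integral_prod _ hi, ← integral_const_mul]
  refine integral_mono_ae (h.integrable_trace.const_mul _) hi.integral_prod_left ?_
  filter_upwards [hi.prod_right_ae] with x hx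
  exact trace_sq_le_of_orthogonal hν
    (continuousOn_snd_slice h.contDiffOn.continuousOn x 0 self_mem_Ici)
    (fun t ht => hasDerivAt_pd2 h.differentiableOn (p := (x, t)) ht)
    (((continuousOn_snd_slice h.contDiffOn_pd2.continuousOn x).mono
      Ioi_subset_Ici_self).aestronglyMeasurable measurableSet_Ioi)
    hx (h.orthogonal x).1 (h.orthogonal x).2

lemma hardy (h : IsEnergySolution ν ε w f) :
    ∫ p in upperHalf, ((1 + p.2) ^ 2)⁻¹ * ‖w p‖ ^ 2 ≤
      2 * (∫ x, ‖w (x, 0)‖ ^ 2) + 4 * ∫ p in upperHalf, ‖pd2 w p‖ ^ 2 := by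
  have hi := h.integrable_pd2
  have hw := h.integrable_weight
  rw [IntegrableOn, volume_restrict_upperHalf] at hi hw
  rw [volume_restrict_upperHalf, integral_prod _ hi, integral_prod _ hw, ← integral_const_mul,
    ← integral_const_mul, ← integral_add (h.integrable_trace.const_mul _)
      (hi.integral_prod_left.const_mul _)]
  refine integral_mono_ae hw.integral_prod_left
    ((h.integrable_trace.const_mul _).add (hi.integral_prod_left.const_mul _)) ?_
  filter_upwards [hi.prod_right_ae, hw.prod_right_ae] with x hx hx'
  exact hardy_half_line (continuousOn_snd_slice h.contDiffOn.continuousOn x)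
    (fun t ht => hasDerivAt_pd2 h.differentiableOn (p := (x, t)) ht) hx' hx

end IsEnergySolution

/-- A product cutoff, vanishing on the lateral and top sides of `[-R, R] × [0, R]`. -/
noncomputable def boxCutoff (R : ℝ) (p : ℝ × ℝ) : ℝ := (1 - (p.1 / R) ^ 2) * (1 - (p.2 / R) ^ 2)

/-- The horizontal derivative of `boxCutoff`. -/
noncomputable def boxCutoffFst (R : ℝ) (p : ℝ × ℝ) : ℝ :=
  -(2 * p.1 / R ^ 2) * (1 - (p.2 / R) ^ 2)

/-- The vertical derivative of `boxCutoff`. -/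
noncomputable def boxCutoffSnd (R : ℝ) (p : ℝ × ℝ) : ℝ :=
  (1 - (p.1 / R) ^ 2) * -(2 * p.2 / R ^ 2)

/-- The open box `(-R, R) × (0, R)`. -/
def openBox (R : ℝ) : Set (ℝ × ℝ) := Ioo (-R) R ×ˢ Ioo 0 R

lemma measurableSet_openBox (R : ℝ) : MeasurableSet (openBox R) :=
  measurableSet_Ioo.prod measurableSet_Ioo

lemma openBox_subset_upperHalf (R : ℝ) : openBox R ⊆ upperHalf := fun _ hp => hp.2.1

lemma hasDerivAt_one_sub_div_sq (R x : ℝ) :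
    HasDerivAt (fun s : ℝ => 1 - (s / R) ^ 2) (-(2 * x / R ^ 2)) x := by
  refine ((((hasDerivAt_id x).div_const R).pow 2).const_sub 1).congr_deriv ?_
  simp; ring

lemma openBox_ae_eq_Icc (R : ℝ) :
    openBox R =ᵐ[volume] Icc ((-R, 0) : ℝ × ℝ) (R, R) := by
  rw [Icc_prod_eq]
  exact Measure.set_prod_ae_eq Ioo_ae_eq_Icc Ioo_ae_eq_Icc

/-- The divergence of `χ w̄ ∇w`, where `χ` is the cutoff `boxCutoff R`. -/
noncomputable def energyDensity (w : ℝ × ℝ → ℂ) (R : ℝ) (p : ℝ × ℝ) : ℂ :=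
  boxCutoff R p • (star (pd1 w p) * pd1 w p + star (pd2 w p) * pd2 w p
      + star (w p) * (pd1 (pd1 w) p + pd2 (pd2 w) p))
    + (boxCutoffFst R p • (star (w p) * pd1 w p) + boxCutoffSnd R p • (star (w p) * pd2 w p))

namespace IsEnergySolution

variable {ν ε : ℝ} {w f : ℝ × ℝ → ℂ}

lemma integral_energyDensity (h : IsEnergySolution ν ε w f) {R : ℝ} (hR : 0 < R) :
    ∫ p in openBox R, energyDensity w R p =
      ν * ∫ x in (-R)..R, (((1 - (x / R) ^ 2) * ‖w (x, 0)‖ ^ 2 : ℝ) : ℂ) := by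
  have hsub : Icc ((-R, 0) : ℝ × ℝ) (R, R) ⊆ closedHalf := fun p hp => hp.1.2
  have cw := h.contDiffOn.continuousOn
  have c1 := h.contDiffOn_pd1.continuousOn
  have c2 := h.contDiffOn_pd2.continuousOn
  have c11 : ContinuousOn (pd1 (pd1 w)) closedHalf :=
    (_root_.contDiffOn_pd1 (m := 0) h.contDiffOn_pd1 (by norm_num)).continuousOn
  have c22 : ContinuousOn (pd2 (pd2 w)) closedHalf :=
    (_root_.contDiffOn_pd2 (m := 0) h.contDiffOn_pd2 (by norm_num)).continuousOn
  have dw := h.differentiableOn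
  have d1 := h.contDiffOn_pd1.differentiableOn one_ne_zero
  have d2 := h.contDiffOn_pd2.differentiableOn one_ne_zero
  have hχ : Differentiable ℝ (boxCutoff R) := by unfold boxCutoff; fun_prop
  have hχ1 : Continuous (boxCutoffFst R) := by unfold boxCutoffFst; fun_prop
  have hχ2 : Continuous (boxCutoffSnd R) := by unfold boxCutoffSnd; fun_prop
  have hEc : ContinuousOn (energyDensity w R) closedHalf := by
    unfold energyDensity
    exact (hχ.continuous.continuousOn.smul (((c1.star.mul c1).add (c2.star.mul c2)).add
      (cw.star.mul (c11.add c22)))).add ((hχ1.continuousOn.smul (cw.star.mul c1)).add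
        (hχ2.continuousOn.smul (cw.star.mul c2)))
  set F : ℝ × ℝ → ℂ := fun p => boxCutoff R p • (star (w p) * pd1 w p) with hF
  set G : ℝ × ℝ → ℂ := fun p => boxCutoff R p • (star (w p) * pd2 w p) with hG
  have hFd : ∀ p ∈ upperHalf, DifferentiableAt ℝ F p := fun p hp =>
    hχ.differentiableAt.smul (((dw.differentiableAt (closedHalf_mem_nhds hp)).star).mul
      (d1.differentiableAt (closedHalf_mem_nhds hp)))
  have hGd : ∀ p ∈ upperHalf, DifferentiableAt ℝ G p := fun p hp =>
    hχ.differentiableAt.smul (((dw.differentiableAt (closedHalf_mem_nhds hp)).star).mul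
      (d2.differentiableAt (closedHalf_mem_nhds hp)))
  have hdiv : ∀ p ∈ upperHalf, fderiv ℝ F p (1, 0) + fderiv ℝ G p (0, 1) = energyDensity w R p := by
    intro p hp
    have hp' := upperHalf_subset_closedHalf hp
    have e1 : HasDerivAt (fun s : ℝ => F (s, p.2)) (fderiv ℝ F p (1, 0)) p.1 :=
      HasFDerivAt.comp_hasDerivAt (f := fun s : ℝ => (s, p.2)) p.1 (hFd p hp).hasFDerivAt
        ((hasDerivAt_id p.1).prodMk (hasDerivAt_const p.1 p.2))
    have e2 : HasDerivAt (fun s : ℝ => G (p.1, s)) (fderiv ℝ G p (0, 1)) p.2 :=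
      HasFDerivAt.comp_hasDerivAt (f := fun s : ℝ => (p.1, s)) p.2 (hGd p hp).hasFDerivAt
        ((hasDerivAt_const p.2 p.1).prodMk (hasDerivAt_id p.2))
    have e1' := ((hasDerivAt_one_sub_div_sq R p.1).mul_const (1 - (p.2 / R) ^ 2)).smul
      ((hasDerivAt_pd1 dw hp').star.mul (hasDerivAt_pd1 d1 hp'))
    have e2' := ((hasDerivAt_one_sub_div_sq R p.2).const_mul (1 - (p.1 / R) ^ 2)).smul
      ((hasDerivAt_pd2 dw hp).star.mul (hasDerivAt_pd2 d2 hp))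
    rw [e1.unique e1', e2.unique e2']
    simp only [energyDensity, boxCutoff, boxCutoffFst, boxCutoffSnd, Complex.real_smul]
    simp only [Pi.mul_apply]
    ring
  have hbox : ∀ p ∈ Ioo (-R) R ×ˢ Ioo 0 R, p ∈ upperHalf := fun p hp => hp.2.1
  have hae : (fun p => fderiv ℝ F p (1, 0) + fderiv ℝ G p (0, 1))
      =ᵐ[volume.restrict (Icc ((-R, 0) : ℝ × ℝ) (R, R))] energyDensity w R := by
    rw [← Measure.restrict_congr_set (openBox_ae_eq_Icc R)]
    filter_upwards [ae_restrict_mem (measurableSet_openBox R)] with p hp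
    exact hdiv p (openBox_subset_upperHalf R hp)
  have hEi : IntegrableOn (energyDensity w R) (Icc ((-R, 0) : ℝ × ℝ) (R, R)) :=
    (hEc.mono hsub).integrableOn_compact isCompact_Icc
  have key := integral_divergence_prod_Icc_of_hasFDerivAt_of_le F G (fderiv ℝ F) (fderiv ℝ G)
    (-R, 0) (R, R) ⟨by simp; linarith, hR.le⟩
    ((hχ.continuous.continuousOn.smul (cw.star.mul c1)).mono hsub)
    ((hχ.continuous.continuousOn.smul (cw.star.mul c2)).mono hsub)
    (fun p hp => (hFd p (hbox p hp)).hasFDerivAt)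
    (fun p hp => (hGd p (hbox p hp)).hasFDerivAt)
    (hEi.congr hae.symm)
  rw [setIntegral_congr_set (openBox_ae_eq_Icc R), ← integral_congr_ae hae, key]
  have z1 : ∀ y, F (R, y) = 0 := fun y => by simp [hF, boxCutoff, hR.ne']
  have z2 : ∀ y, F (-R, y) = 0 := fun y => by simp [hF, boxCutoff, hR.ne']
  have z3 : ∀ x, G (x, R) = 0 := fun y => by simp [hG, boxCutoff, hR.ne']
  have z4 : ∀ x, G (x, 0) = -(ν * (((1 - (x / R) ^ 2) * ‖w (x, 0)‖ ^ 2 : ℝ) : ℂ)) := fun x => by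
    have hb : pd2 w (x, 0) = -(ν * w (x, 0)) := by rw [← h.robin x, neg_neg]
    have hn : star (w (x, 0)) * w (x, 0) = ((‖w (x, 0)‖ ^ 2 : ℝ) : ℂ) := by
      rw [Complex.ofReal_pow]; exact Complex.conj_mul' _
    simp only [hG, boxCutoff, hb, Complex.real_smul]
    rw [Complex.ofReal_mul (1 - (x / R) ^ 2) (‖w (x, 0)‖ ^ 2), ← hn]
    push_cast
    simp
    ring
  simp only [z1, z2, z3, z4, intervalIntegral.integral_zero, intervalIntegral.integral_neg,
    intervalIntegral.integral_const_mul]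
  ring

end IsEnergySolution

lemma abs_one_sub_div_sq_le {R x : ℝ} (hx : |x| ≤ R) : |1 - (x / R) ^ 2| ≤ 1 := by
  have h0 : 0 ≤ R := (abs_nonneg x).trans hx
  have h1 : (x / R) ^ 2 ≤ 1 := by
    rw [div_pow]
    exact div_le_one_of_le₀ (sq_le_sq' (by linarith [abs_le.1 hx]) (abs_le.1 hx).2) (by positivity)
  rw [abs_le]
  constructor <;> nlinarith [sq_nonneg (x / R)]

lemma abs_two_mul_div_sq_le {R x t : ℝ} (hR : 1 ≤ R) (hx : |x| ≤ R) (ht : 0 < t) (htR : t ≤ R) :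
    |2 * x / R ^ 2| ≤ 4 * (1 + t)⁻¹ := by
  have h1 : |2 * x / R ^ 2| ≤ 2 / R := by
    rw [abs_div, abs_mul, abs_of_pos (show (0 : ℝ) < R ^ 2 by positivity), div_le_div_iff₀
      (by positivity) (by positivity)]
    norm_num
    nlinarith
  refine h1.trans ?_
  rw [div_le_iff₀ (by positivity), mul_right_comm, ← div_eq_mul_inv, le_div_iff₀ (by positivity)]
  linarith

lemma abs_boxCutoff_le {R : ℝ} {p : ℝ × ℝ} (hp : p ∈ openBox R) : |boxCutoff R p| ≤ 1 := by
  have h1 : |p.1| ≤ R := abs_le.2 ⟨hp.1.1.le, hp.1.2.le⟩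
  have h2 : |p.2| ≤ R := abs_le.2 ⟨by linarith [hp.2.1, hp.2.2], hp.2.2.le⟩
  rw [boxCutoff, abs_mul]
  exact mul_le_one₀ (abs_one_sub_div_sq_le h1) (abs_nonneg _) (abs_one_sub_div_sq_le h2)

lemma abs_boxCutoffFst_le {R : ℝ} (hR : 1 ≤ R) {p : ℝ × ℝ} (hp : p ∈ openBox R) :
    |boxCutoffFst R p| ≤ 4 * (1 + p.2)⁻¹ := by
  have h1 : |p.1| ≤ R := abs_le.2 ⟨hp.1.1.le, hp.1.2.le⟩
  have h2 : |p.2| ≤ R := abs_le.2 ⟨by linarith [hp.2.1, hp.2.2], hp.2.2.le⟩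
  have h3 := abs_two_mul_div_sq_le hR h1 hp.2.1 hp.2.2.le
  rw [boxCutoffFst, abs_mul, abs_neg]
  exact (mul_le_of_le_one_right (abs_nonneg _) (abs_one_sub_div_sq_le h2)).trans h3

lemma abs_boxCutoffSnd_le {R : ℝ} (hR : 1 ≤ R) {p : ℝ × ℝ} (hp : p ∈ openBox R) :
    |boxCutoffSnd R p| ≤ 4 * (1 + p.2)⁻¹ := by
  have h1 : |p.1| ≤ R := abs_le.2 ⟨hp.1.1.le, hp.1.2.le⟩
  have h2 : |p.2| ≤ R := abs_le.2 ⟨by linarith [hp.2.1, hp.2.2], hp.2.2.le⟩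
  have h3 := abs_two_mul_div_sq_le hR h2 hp.2.1 hp.2.2.le
  rw [boxCutoffSnd, abs_mul, abs_neg]
  exact (mul_le_of_le_one_left (abs_nonneg _) (abs_one_sub_div_sq_le h1)).trans h3

lemma tendsto_one_sub_div_sq (x : ℝ) :
    Filter.Tendsto (fun n : ℕ => 1 - (x / ((n : ℝ) + 1)) ^ 2) Filter.atTop (nhds 1) := by
  have h := (tendsto_const_div_atTop_nhds_zero_nat x).comp (Filter.tendsto_add_atTop_nat 1)
  simpa [Function.comp_def] using (h.pow 2).const_sub 1

lemma tendsto_two_mul_div_sq (x : ℝ) :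
    Filter.Tendsto (fun n : ℕ => -(2 * x / ((n : ℝ) + 1) ^ 2)) Filter.atTop (nhds 0) := by
  have h1 := (tendsto_const_div_atTop_nhds_zero_nat (2 * x)).comp (Filter.tendsto_add_atTop_nat 1)
  have h2 := (tendsto_const_div_atTop_nhds_zero_nat (1 : ℝ)).comp (Filter.tendsto_add_atTop_nat 1)
  have h3 := (h1.mul h2).neg
  simp only [mul_zero, neg_zero] at h3
  refine h3.congr fun n => ?_
  simp only [Function.comp_def]
  push_cast
  field_simp

lemma eventually_mem_openBox {p : ℝ × ℝ} (hp : p ∈ upperHalf) :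
    ∀ᶠ n : ℕ in Filter.atTop, p ∈ openBox ((n : ℝ) + 1) := by
  filter_upwards [Filter.eventually_ge_atTop ⌈|p.1| + |p.2|⌉₊] with n hn
  have h1 : |p.1| + |p.2| ≤ n := (Nat.le_ceil _).trans (by exact_mod_cast hn)
  have h2 := abs_le.1 (le_refl |p.1|)
  have h3 := le_abs_self p.2
  refine ⟨⟨?_, ?_⟩, hp, ?_⟩ <;> linarith [abs_nonneg p.1, abs_nonneg p.2]

lemma norm_mul_norm_le_weighted {a t x y : ℝ} (ha : 0 < a) (ht : 0 < t) :
    x * y ≤ 1 / (2 * a) * (((1 + t) ^ 2)⁻¹ * x ^ 2) + a / 2 * ((1 + t) ^ 2 * y ^ 2) := by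
  have h0 : 0 < 1 + t := by positivity
  have h1 : 1 / (2 * a) * (((1 + t) ^ 2)⁻¹ * x ^ 2) + a / 2 * ((1 + t) ^ 2 * y ^ 2) - x * y
      = ((1 + t)⁻¹ * x - a * ((1 + t) * y)) ^ 2 / (2 * a) := by
    field_simp
    ring
  have h2 : 0 ≤ ((1 + t)⁻¹ * x - a * ((1 + t) * y)) ^ 2 / (2 * a) := by positivity
  linarith

lemma integrableOn_star_mul {w f : ℝ × ℝ → ℂ} (hw : ContinuousOn w closedHalf)
    (hf : ContinuousOn f upperHalf)
    (hwi : IntegrableOn (fun p : ℝ × ℝ => ((1 + p.2) ^ 2)⁻¹ * ‖w p‖ ^ 2) upperHalf)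
    (hfi : IntegrableOn (fun p : ℝ × ℝ => (1 + p.2) ^ 2 * ‖f p‖ ^ 2) upperHalf) :
    IntegrableOn (fun p => star (w p) * f p) upperHalf := by
  refine ((hwi.const_mul (1 / (2 * 1))).add (hfi.const_mul (1 / 2))).mono'
    (((hw.mono upperHalf_subset_closedHalf).star.mul hf).aestronglyMeasurable
      measurableSet_upperHalf) ?_
  filter_upwards [ae_restrict_mem measurableSet_upperHalf] with p hp
  rw [norm_mul, norm_star]
  exact norm_mul_norm_le_weighted one_pos hp

namespace IsEnergySolution

variable {ν ε : ℝ} {w f : ℝ × ℝ → ℂ}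

lemma integrable_star_mul_source (h : IsEnergySolution ν ε w f) :
    IntegrableOn (fun p => star (w p) * f p) upperHalf :=
  integrableOn_star_mul h.contDiffOn.continuousOn h.continuousOn_source h.integrable_weight
    h.integrable_source

/-- The energy identity, in complex form. -/
lemma energy_identity (h : IsEnergySolution ν ε w f) :
    ∫ p in upperHalf, (((‖pd1 w p‖ ^ 2 + ‖pd2 w p‖ ^ 2 : ℝ) : ℂ) + star (w p) * f p
        + Complex.I * ((ε * ‖w p‖ ^ 2 : ℝ) : ℂ)) =
      ν * ∫ x, ((‖w (x, 0)‖ ^ 2 : ℝ) : ℂ) := by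
  set L : ℝ × ℝ → ℂ := fun p => ((‖pd1 w p‖ ^ 2 + ‖pd2 w p‖ ^ 2 : ℝ) : ℂ) + star (w p) * f p
        + Complex.I * ((ε * ‖w p‖ ^ 2 : ℝ) : ℂ) with hL
  have hLi : IntegrableOn L upperHalf :=
    ((h.integrable_pd1.add h.integrable_pd2).ofReal.add h.integrable_star_mul_source).add
      (h.integrable_absorption.ofReal.const_mul _)
  have hsq : ∀ z : ℂ, star z * z = ((‖z‖ ^ 2 : ℝ) : ℂ) := fun z => by
    rw [Complex.ofReal_pow]; exact Complex.conj_mul' _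
  have hE : ∀ p ∈ upperHalf, ∀ R : ℝ, energyDensity w R p = boxCutoff R p • L p
      + (boxCutoffFst R p • (star (w p) * pd1 w p)
        + boxCutoffSnd R p • (star (w p) * pd2 w p)) := by
    intro p hp R
    have he : pd1 (pd1 w) p + pd2 (pd2 w) p = f p + Complex.I * ε * w p := by
      rw [← h.equation p hp]; ring
    rw [energyDensity, he, hsq, hsq, hL]
    congr 2
    have := hsq (w p)
    push_cast at this ⊢
    rw [← this]
    ring
  have hmeas : ∀ R : ℝ, AEStronglyMeasurable (energyDensity w R) (volume.restrict upperHalf) := by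
    intro R
    have c1 : AEStronglyMeasurable _ (volume.restrict upperHalf) := (h.contDiffOn_pd1.continuousOn.mono
      upperHalf_subset_closedHalf).aestronglyMeasurable measurableSet_upperHalf
    have c2 : AEStronglyMeasurable _ (volume.restrict upperHalf) := (h.contDiffOn_pd2.continuousOn.mono
      upperHalf_subset_closedHalf).aestronglyMeasurable measurableSet_upperHalf
    have cw : AEStronglyMeasurable _ (volume.restrict upperHalf) := (h.contDiffOn.continuousOn.mono
      upperHalf_subset_closedHalf).aestronglyMeasurable measurableSet_upperHalf
    have hχ : Continuous (boxCutoff R) := by unfold boxCutoff; fun_prop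
    have hχ1 : Continuous (boxCutoffFst R) := by unfold boxCutoffFst; fun_prop
    have hχ2 : Continuous (boxCutoffSnd R) := by unfold boxCutoffSnd; fun_prop
    refine ((hχ.aestronglyMeasurable.smul hLi.1).add
      ((hχ1.aestronglyMeasurable.smul (cw.star.mul c1)).add
        (hχ2.aestronglyMeasurable.smul (cw.star.mul c2)))).congr ?_
    filter_upwards [ae_restrict_mem measurableSet_upperHalf] with p hp
    exact (hE p hp R).symm
  have hleft : Filter.Tendsto (fun n : ℕ => ∫ p in upperHalf,
      (openBox ((n : ℝ) + 1)).indicator (energyDensity w ((n : ℝ) + 1)) p) Filter.atTop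
      (nhds (∫ p in upperHalf, L p)) := by
    refine tendsto_integral_of_dominated_convergence
      (fun p => ‖L p‖ + (4 * (((1 + p.2) ^ 2)⁻¹ * ‖w p‖ ^ 2)
        + (2 * ‖pd1 w p‖ ^ 2 + 2 * ‖pd2 w p‖ ^ 2)))
      (fun n => (hmeas _).indicator (measurableSet_openBox _))
      (hLi.norm.add ((h.integrable_weight.const_mul 4).add
        ((h.integrable_pd1.const_mul 2).add (h.integrable_pd2.const_mul 2)))) ?_ ?_
    · intro n
      filter_upwards [ae_restrict_mem measurableSet_upperHalf] with p hp
      have h0 : (0 : ℝ) < 1 + p.2 := by have : 0 < p.2 := hp; positivity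
      by_cases hb : p ∈ openBox ((n : ℝ) + 1)
      · rw [indicator_of_mem hb, hE p hp]
        have hR : (1 : ℝ) ≤ (n : ℝ) + 1 := by simp
        have b0 := abs_boxCutoff_le hb
        have b1 := abs_boxCutoffFst_le hR hb
        have b2 := abs_boxCutoffSnd_le hR hb
        have t0 : ‖boxCutoff ((n : ℝ) + 1) p • L p‖ ≤ ‖L p‖ := by
          rw [norm_smul]; exact mul_le_of_le_one_left (norm_nonneg _) b0
        have t1 : ‖boxCutoffFst ((n : ℝ) + 1) p • (star (w p) * pd1 w p)‖
            ≤ 4 * (1 + p.2)⁻¹ * (‖w p‖ * ‖pd1 w p‖) := by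
          rw [norm_smul, norm_mul, norm_star]
          exact mul_le_mul_of_nonneg_right b1 (by positivity)
        have t2 : ‖boxCutoffSnd ((n : ℝ) + 1) p • (star (w p) * pd2 w p)‖
            ≤ 4 * (1 + p.2)⁻¹ * (‖w p‖ * ‖pd2 w p‖) := by
          rw [norm_smul, norm_mul, norm_star]
          exact mul_le_mul_of_nonneg_right b2 (by positivity)
        refine (norm_add_le _ _).trans (add_le_add t0 ((norm_add_le _ _).trans
          ((add_le_add t1 t2).trans ?_)))
        rw [← inv_pow, ← mul_pow]
        nlinarith [sq_nonneg ((1 + p.2)⁻¹ * ‖w p‖ - ‖pd1 w p‖),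
          sq_nonneg ((1 + p.2)⁻¹ * ‖w p‖ - ‖pd2 w p‖)]
      · rw [indicator_of_notMem hb, norm_zero]
        positivity
    · filter_upwards [ae_restrict_mem measurableSet_upperHalf] with p hp
      have l0 : Filter.Tendsto (fun n : ℕ => boxCutoff ((n : ℝ) + 1) p) Filter.atTop (nhds 1) := by
        simpa [boxCutoff, boxCutoffFst, boxCutoffSnd] using (tendsto_one_sub_div_sq p.1).mul (tendsto_one_sub_div_sq p.2)
      have l1 : Filter.Tendsto (fun n : ℕ => boxCutoffFst ((n : ℝ) + 1) p) Filter.atTop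
          (nhds 0) := by
        simpa [boxCutoff, boxCutoffFst, boxCutoffSnd] using (tendsto_two_mul_div_sq p.1).mul (tendsto_one_sub_div_sq p.2)
      have l2 : Filter.Tendsto (fun n : ℕ => boxCutoffSnd ((n : ℝ) + 1) p) Filter.atTop
          (nhds 0) := by
        simpa [boxCutoff, boxCutoffFst, boxCutoffSnd] using (tendsto_one_sub_div_sq p.1).mul (tendsto_two_mul_div_sq p.2)
      have l := (l0.smul_const (L p)).add ((l1.smul_const (star (w p) * pd1 w p)).add
        (l2.smul_const (star (w p) * pd2 w p)))
      simp only [one_smul, zero_smul, add_zero] at l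
      refine l.congr' ?_
      filter_upwards [eventually_mem_openBox hp] with n hn
      rw [indicator_of_mem hn, hE p hp]
  have hright : Filter.Tendsto (fun n : ℕ => ∫ x in Ioc (-((n : ℝ) + 1)) ((n : ℝ) + 1),
      (((1 - (x / ((n : ℝ) + 1)) ^ 2) * ‖w (x, 0)‖ ^ 2 : ℝ) : ℂ)) Filter.atTop
      (nhds (∫ x, ((‖w (x, 0)‖ ^ 2 : ℝ) : ℂ))) := by
    simp_rw [← integral_indicator (measurableSet_Ioc (α := ℝ))]
    refine tendsto_integral_of_dominated_convergence (fun x => ‖w (x, 0)‖ ^ 2) ?_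
      h.integrable_trace ?_ ?_
    · intro n
      refine AEStronglyMeasurable.indicator ?_ measurableSet_Ioc
      exact Complex.continuous_ofReal.comp_aestronglyMeasurable
        ((Continuous.aestronglyMeasurable (by fun_prop)).mul h.integrable_trace.1)
    · intro n
      refine Filter.Eventually.of_forall fun x => ?_
      by_cases hx : x ∈ Ioc (-((n : ℝ) + 1)) ((n : ℝ) + 1)
      · rw [indicator_of_mem hx, Complex.norm_real, norm_mul, Real.norm_eq_abs,
          norm_pow, norm_norm]
        exact mul_le_of_le_one_left (by positivity)
          (abs_one_sub_div_sq_le (abs_le.2 ⟨hx.1.le, hx.2⟩))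
      · rw [indicator_of_notMem hx, norm_zero]
        positivity
    · refine Filter.Eventually.of_forall fun x => ?_
      have l := (Complex.continuous_ofReal.tendsto _).comp
        ((tendsto_one_sub_div_sq x).mul_const (‖w (x, 0)‖ ^ 2))
      rw [one_mul] at l
      refine l.congr' ?_
      filter_upwards [Filter.eventually_ge_atTop ⌈|x|⌉₊] with n hn
      have h1 : |x| ≤ n := (Nat.le_ceil _).trans (by exact_mod_cast hn)
      have h2 := abs_le.1 h1
      rw [indicator_of_mem (show x ∈ Ioc (-((n : ℝ) + 1)) ((n : ℝ) + 1) from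
        ⟨by linarith, by linarith⟩)]
      rfl
  refine tendsto_nhds_unique hleft ((hright.const_mul (ν : ℂ)).congr fun n => ?_)
  have hR : (0 : ℝ) < (n : ℝ) + 1 := by positivity
  rw [setIntegral_indicator (measurableSet_openBox _),
    inter_eq_self_of_subset_right (openBox_subset_upperHalf _), h.integral_energyDensity hR,
    intervalIntegral.integral_of_le (by linarith)]

lemma energy_identity_split (h : IsEnergySolution ν ε w f) :
    (((∫ p in upperHalf, ‖pd1 w p‖ ^ 2) + ∫ p in upperHalf, ‖pd2 w p‖ ^ 2 : ℝ) : ℂ)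
        + (∫ p in upperHalf, star (w p) * f p)
        + Complex.I * ((∫ p in upperHalf, ε * ‖w p‖ ^ 2 : ℝ) : ℂ) =
      ((ν * ∫ x, ‖w (x, 0)‖ ^ 2 : ℝ) : ℂ) := by
  have i1 : IntegrableOn (fun p => ((‖pd1 w p‖ ^ 2 + ‖pd2 w p‖ ^ 2 : ℝ) : ℂ)) upperHalf :=
    (h.integrable_pd1.add h.integrable_pd2).ofReal
  have i2 : IntegrableOn (fun p => Complex.I * ((ε * ‖w p‖ ^ 2 : ℝ) : ℂ)) upperHalf :=
    h.integrable_absorption.ofReal.const_mul _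
  have i3 : IntegrableOn (fun p => ((‖pd1 w p‖ ^ 2 + ‖pd2 w p‖ ^ 2 : ℝ) : ℂ) + star (w p) * f p)
    upperHalf := i1.add h.integrable_star_mul_source
  have key := h.energy_identity
  rw [integral_add i3 i2, integral_add i1 h.integrable_star_mul_source, integral_const_mul,
    integral_complex_ofReal, integral_complex_ofReal, integral_complex_ofReal,
    integral_add h.integrable_pd1 h.integrable_pd2] at key
  rw [key, Complex.ofReal_mul]

lemma re_energy_identity (h : IsEnergySolution ν ε w f) :
    (∫ p in upperHalf, ‖pd1 w p‖ ^ 2) + (∫ p in upperHalf, ‖pd2 w p‖ ^ 2)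
        + (∫ p in upperHalf, star (w p) * f p).re = ν * ∫ x, ‖w (x, 0)‖ ^ 2 := by
  have key := congrArg Complex.re h.energy_identity_split
  rw [Complex.ofReal_re] at key
  rw [← key]
  simp only [Complex.add_re, Complex.ofReal_re, Complex.mul_re, Complex.I_re, Complex.I_im,
    Complex.ofReal_im]
  ring

lemma im_energy_identity (h : IsEnergySolution ν ε w f) :
    (∫ p in upperHalf, star (w p) * f p).im + (∫ p in upperHalf, ε * ‖w p‖ ^ 2) = 0 := by
  have key := congrArg Complex.im h.energy_identity_split
  rw [Complex.ofReal_im] at key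
  rw [← key]
  simp only [Complex.add_im, Complex.ofReal_re, Complex.mul_im, Complex.I_re, Complex.I_im,
    Complex.ofReal_im]
  ring

lemma coercive (h : IsEnergySolution ν ε w f) (hν : 0 < ν) :
    (∫ p in upperHalf, ‖pd1 w p‖ ^ 2) + (1 / 2) * (∫ p in upperHalf, ‖pd2 w p‖ ^ 2)
      ≤ -(∫ p in upperHalf, star (w p) * f p).re := by
  linarith [h.re_energy_identity, h.trace_le hν]

lemma norm_integral_star_mul_source_le (h : IsEnergySolution ν ε w f) {a : ℝ} (ha : 0 < a) :
    ‖∫ p in upperHalf, star (w p) * f p‖ ≤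
      1 / (2 * a) * (∫ p in upperHalf, ((1 + p.2) ^ 2)⁻¹ * ‖w p‖ ^ 2)
        + a / 2 * ∫ p in upperHalf, (1 + p.2) ^ 2 * ‖f p‖ ^ 2 := by
  rw [← integral_const_mul, ← integral_const_mul,
    ← integral_add (h.integrable_weight.const_mul _) (h.integrable_source.const_mul _)]
  refine norm_integral_le_of_norm_le
    ((h.integrable_weight.const_mul _).add (h.integrable_source.const_mul _)) ?_
  filter_upwards [ae_restrict_mem measurableSet_upperHalf] with p hp
  rw [norm_mul, norm_star]
  exact norm_mul_norm_le_weighted ha hp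

/-- The weighted `L²` estimate. -/
lemma weighted_le (h : IsEnergySolution ν ε w f) (hν : 0 < ν) :
    ∫ p in upperHalf, ((1 + p.2) ^ 2)⁻¹ * ‖w p‖ ^ 2 ≤
      128 * ((1 + ν ^ 2) / ν ^ 2) * ∫ p in upperHalf, (1 + p.2) ^ 2 * ‖f p‖ ^ 2 := by
  have hK : 0 < 2 * (4 + 1 / ν) := by positivity
  have h1 := h.coercive hν
  have h2 := h.trace_le hν
  have h3 := h.hardy
  have h4 := h.norm_integral_star_mul_source_le hK
  have h5 := (abs_le.1 ((Complex.abs_re_le_norm _).trans h4)).1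
  set N := ∫ p in upperHalf, ((1 + p.2) ^ 2)⁻¹ * ‖w p‖ ^ 2
  set F := ∫ p in upperHalf, (1 + p.2) ^ 2 * ‖f p‖ ^ 2 with hF
  set X := ∫ p in upperHalf, ‖pd1 w p‖ ^ 2 with hX
  set Y := ∫ p in upperHalf, ‖pd2 w p‖ ^ 2
  set T := ∫ x, ‖w (x, 0)‖ ^ 2
  set K := 2 * (4 + 1 / ν) with hKdef
  have hF0 : 0 ≤ F := integral_nonneg fun p => by positivity
  have hX0 : 0 ≤ X := integral_nonneg fun p => by positivity
  have hT : T ≤ Y / (2 * ν) := by rw [le_div_iff₀ (by positivity)]; linarith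
  have hNY : N ≤ K * (Y / 2) := by
    have : K * (Y / 2) = 2 * (Y / (2 * ν)) + 4 * Y := by rw [hKdef]; field_simp; ring
    linarith
  have hY : Y / 2 ≤ 1 / (2 * K) * N + K / 2 * F := by linarith
  have hN : N ≤ N / 2 + K ^ 2 / 2 * F := by
    have h6 := hNY.trans (mul_le_mul_of_nonneg_left hY hK.le)
    have : K * (1 / (2 * K) * N + K / 2 * F) = N / 2 + K ^ 2 / 2 * F := by field_simp
    linarith
  have hKν : K ^ 2 ≤ 128 * ((1 + ν ^ 2) / ν ^ 2) := by
    have e : (1 + ν ^ 2) / ν ^ 2 = (1 / ν) ^ 2 + 1 := by field_simp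
    rw [e, hKdef]
    nlinarith [sq_nonneg (4 - 1 / ν), sq_nonneg (1 / ν)]
  have := mul_le_mul_of_nonneg_right hKν hF0
  linarith

lemma integrable_norm_sq_source (h : IsEnergySolution ν ε w f) :
    IntegrableOn (fun p => ‖f p‖ ^ 2) upperHalf ∧
      ∫ p in upperHalf, ‖f p‖ ^ 2 ≤ ∫ p in upperHalf, (1 + p.2) ^ 2 * ‖f p‖ ^ 2 := by
  have hle : ∀ p ∈ upperHalf, ‖f p‖ ^ 2 ≤ (1 + p.2) ^ 2 * ‖f p‖ ^ 2 := fun p hp => by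
    have h0 : 0 < p.2 := hp
    exact le_mul_of_one_le_left (by positivity) (by nlinarith)
  have hi : IntegrableOn (fun p => ‖f p‖ ^ 2) upperHalf := by
    refine h.integrable_source.mono'
      ((h.continuousOn_source.norm.pow 2).aestronglyMeasurable measurableSet_upperHalf) ?_
    filter_upwards [ae_restrict_mem measurableSet_upperHalf] with p hp
    rw [Real.norm_of_nonneg (by positivity)]
    exact hle p hp
  exact ⟨hi, setIntegral_mono_on hi h.integrable_source measurableSet_upperHalf hle⟩

/-- The absorption term is controlled in `L²` by the source. -/
lemma absorption_le (h : IsEnergySolution ν ε w f) :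
    IntegrableOn (fun p => ε ^ 2 * ‖w p‖ ^ 2) upperHalf ∧
      ∫ p in upperHalf, ε ^ 2 * ‖w p‖ ^ 2 ≤ ∫ p in upperHalf, ‖f p‖ ^ 2 := by
  obtain ⟨hf, -⟩ := h.integrable_norm_sq_source
  have hi : IntegrableOn (fun p => ε ^ 2 * ‖w p‖ ^ 2) upperHalf := by
    refine (h.integrable_absorption.const_mul ε).congr (Filter.Eventually.of_forall fun p => ?_)
    simp only
    ring
  refine ⟨hi, ?_⟩
  rcases eq_or_ne ε 0 with rfl | hε
  · simpa using integral_nonneg fun p => by positivity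
  have hpair : ‖∫ p in upperHalf, star (w p) * f p‖ ≤
      1 / (2 * |ε|) * (∫ p in upperHalf, ε ^ 2 * ‖w p‖ ^ 2)
        + 1 / (2 * |ε|) * ∫ p in upperHalf, ‖f p‖ ^ 2 := by
    rw [← integral_const_mul, ← integral_const_mul,
      ← integral_add (hi.const_mul _) (hf.const_mul _)]
    refine norm_integral_le_of_norm_le ((hi.const_mul _).add (hf.const_mul _))
      (Filter.Eventually.of_forall fun p => ?_)
    rw [norm_mul, norm_star, ← sq_abs ε]
    have hε' : 0 < |ε| := abs_pos.2 hε
    have h1 : 1 / (2 * |ε|) * (|ε| ^ 2 * ‖w p‖ ^ 2) + 1 / (2 * |ε|) * ‖f p‖ ^ 2 - ‖w p‖ * ‖f p‖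
      = (|ε| * ‖w p‖ - ‖f p‖) ^ 2 / (2 * |ε|) := by field_simp; ring
    have h2 : 0 ≤ (|ε| * ‖w p‖ - ‖f p‖) ^ 2 / (2 * |ε|) := by positivity
    linarith
  have him := h.im_energy_identity
  have habs : |∫ p in upperHalf, ε * ‖w p‖ ^ 2| ≤ ‖∫ p in upperHalf, star (w p) * f p‖ := by
    rw [← abs_neg, ← eq_neg_of_add_eq_zero_left him]
    exact Complex.abs_im_le_norm _
  have hle := habs.trans hpair
  rw [integral_const_mul, abs_mul,
    abs_of_nonneg (integral_nonneg fun p => by positivity)] at hle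
  rw [integral_const_mul] at hle ⊢
  have hε' : 0 < |ε| := abs_pos.2 hε
  have := mul_le_mul_of_nonneg_left hle (show 0 ≤ 2 * |ε| by positivity)
  rw [← sq_abs ε] at this ⊢
  set W := ∫ p in upperHalf, ‖w p‖ ^ 2
  set F := ∫ p in upperHalf, ‖f p‖ ^ 2
  have e : 2 * |ε| * (1 / (2 * |ε|) * (|ε| ^ 2 * W) + 1 / (2 * |ε|) * F) = |ε| ^ 2 * W + F := by
    field_simp
  rw [e] at this
  nlinarith

end IsEnergySolution

lemma measurePreserving_shift (h : ℝ) :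
    MeasurePreserving (fun p : ℝ × ℝ => (p.1 + h, p.2)) (volume.restrict upperHalf)
      (volume.restrict upperHalf) := by
  rw [volume_restrict_upperHalf]
  exact (measurePreserving_add_right volume h).prod (MeasurePreserving.id _)

lemma measurableEmbedding_shift (h : ℝ) :
    MeasurableEmbedding (fun p : ℝ × ℝ => (p.1 + h, p.2)) :=
  ((Homeomorph.addRight h).prodCongr (Homeomorph.refl ℝ)).measurableEmbedding

lemma integrableOn_shift {E : Type*} [NormedAddCommGroup E] {g : ℝ × ℝ → E}
    (hg : IntegrableOn g upperHalf) (h : ℝ) :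
    IntegrableOn (fun p => g (p.1 + h, p.2)) upperHalf :=
  ((measurePreserving_shift h).integrable_comp_emb (measurableEmbedding_shift h)).2 hg

lemma integral_shift {E : Type*} [NormedAddCommGroup E] [NormedSpace ℝ E] (g : ℝ × ℝ → E)
    (h : ℝ) : ∫ p in upperHalf, g (p.1 + h, p.2) = ∫ p in upperHalf, g p :=
  (measurePreserving_shift h).integral_comp (measurableEmbedding_shift h) g

lemma pd1_shift (w : ℝ × ℝ → ℂ) (h : ℝ) :
    pd1 (fun p => w (p.1 + h, p.2)) = fun p => pd1 w (p.1 + h, p.2) := by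
  ext p
  exact deriv_comp_add_const (f := fun s => w (s, p.2)) h p.1

lemma pd2_shift (w : ℝ × ℝ → ℂ) (h : ℝ) :
    pd2 (fun p => w (p.1 + h, p.2)) = fun p => pd2 w (p.1 + h, p.2) := rfl

lemma eqOn_pd1 {u v : ℝ × ℝ → ℂ} (h : EqOn u v closedHalf) : EqOn (pd1 u) (pd1 v) closedHalf := by
  intro p hp
  have : (fun s => u (s, p.2)) = fun s => v (s, p.2) := funext fun s => h (show (s, p.2) ∈ _ from hp)
  simp only [pd1, this]

lemma eqOn_pd2 {u v : ℝ × ℝ → ℂ} (h : EqOn u v closedHalf) : EqOn (pd2 u) (pd2 v) closedHalf :=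
  fun _ hp => derivWithin_congr (fun _ ht => h ht) (h hp)

lemma pd1_sub {u v : ℝ × ℝ → ℂ} (hu : DifferentiableOn ℝ u closedHalf)
    (hv : DifferentiableOn ℝ v closedHalf) :
    EqOn (pd1 fun p => u p - v p) (fun p => pd1 u p - pd1 v p) closedHalf :=
  fun _ hp => ((hasDerivAt_pd1 hu hp).sub (hasDerivAt_pd1 hv hp)).deriv

lemma pd2_sub {u v : ℝ × ℝ → ℂ} (hu : DifferentiableOn ℝ u closedHalf)
    (hv : DifferentiableOn ℝ v closedHalf) :
    EqOn (pd2 fun p => u p - v p) (fun p => pd2 u p - pd2 v p) closedHalf :=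
  fun p hp => ((hasDerivWithinAt_pd2 hu hp).sub (hasDerivWithinAt_pd2 hv hp)).derivWithin
    (uniqueDiffOn_Ici 0 p.2 hp)

lemma norm_sub_sq_le (a b : ℂ) : ‖a - b‖ ^ 2 ≤ 2 * ‖a‖ ^ 2 + 2 * ‖b‖ ^ 2 := by
  have := norm_sub_le a b
  nlinarith [norm_nonneg (a - b), sq_nonneg (‖a‖ - ‖b‖)]

/-- Weighted square integrability is stable under subtraction. -/
lemma integrable_mul_norm_sub_sq {α : Type*} [MeasurableSpace α] {μ : Measure α}
    {c : α → ℝ} {u v : α → ℂ} (hc : ∀ p, 0 ≤ c p) (hcm : AEStronglyMeasurable c μ)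
    (hu : Integrable (fun p => c p * ‖u p‖ ^ 2) μ) (hv : Integrable (fun p => c p * ‖v p‖ ^ 2) μ)
    (hm : AEStronglyMeasurable (fun p => u p - v p) μ) :
    Integrable (fun p => c p * ‖u p - v p‖ ^ 2) μ := by
  refine ((hu.const_mul 2).add (hv.const_mul 2)).mono' (hcm.mul (hm.norm.pow 2))
    (Filter.Eventually.of_forall fun p => ?_)
  rw [Real.norm_of_nonneg (mul_nonneg (hc p) (by positivity))]
  have := mul_le_mul_of_nonneg_left (norm_sub_sq_le (u p) (v p)) (hc p)
  simp only [Pi.add_apply]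
  linarith

lemma integrable_norm_sub_sq {α : Type*} [MeasurableSpace α] {μ : Measure α} {u v : α → ℂ}
    (hu : Integrable (fun p => ‖u p‖ ^ 2) μ) (hv : Integrable (fun p => ‖v p‖ ^ 2) μ)
    (hm : AEStronglyMeasurable (fun p => u p - v p) μ) :
    Integrable (fun p => ‖u p - v p‖ ^ 2) μ := by
  simpa only [one_mul] using integrable_mul_norm_sub_sq (c := fun _ => 1) (fun _ => zero_le_one)
    aestronglyMeasurable_const (by simpa only [one_mul] using hu)
    (by simpa only [one_mul] using hv) hm

lemma aestronglyMeasurable_upperHalf {E : Type*} [NormedAddCommGroup E]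
    [SecondCountableTopologyEither (ℝ × ℝ) E] {u : ℝ × ℝ → E}
    (hu : ContinuousOn u closedHalf) :
    AEStronglyMeasurable u (volume.restrict upperHalf) :=
  (hu.mono upperHalf_subset_closedHalf).aestronglyMeasurable measurableSet_upperHalf

namespace IsEnergySolution

variable {ν ε : ℝ} {w f v g : ℝ × ℝ → ℂ}

lemma shift (hw : IsEnergySolution ν ε w f) (h : ℝ) :
    IsEnergySolution ν ε (fun p => w (p.1 + h, p.2)) (fun p => f (p.1 + h, p.2)) where
  contDiffOn := hw.contDiffOn.comp (by fun_prop) fun _ hp => hp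
  equation p hp := by
    rw [pd1_shift, pd1_shift, pd2_shift, pd2_shift]
    exact hw.equation (p.1 + h, p.2) hp
  robin x := hw.robin (x + h)
  orthogonal x := hw.orthogonal (x + h)
  integrable_weight := integrableOn_shift hw.integrable_weight h
  integrable_pd1 := by
    rw [pd1_shift]
    exact integrableOn_shift hw.integrable_pd1 h
  integrable_pd2 := integrableOn_shift hw.integrable_pd2 h
  integrable_trace := hw.integrable_trace.comp_add_right h
  integrable_source := integrableOn_shift hw.integrable_source h
  integrable_absorption := integrableOn_shift hw.integrable_absorption h

lemma sub (hw : IsEnergySolution ν ε w f) (hv : IsEnergySolution ν ε v g) :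
    IsEnergySolution ν ε (fun p => w p - v p) (fun p => f p - g p) where
  contDiffOn := hw.contDiffOn.sub hv.contDiffOn
  equation p hp := by
    have hp' := upperHalf_subset_closedHalf hp
    have h1 := (eqOn_pd1 (pd1_sub hw.differentiableOn hv.differentiableOn)).trans
      (pd1_sub (hw.contDiffOn_pd1.differentiableOn one_ne_zero)
        (hv.contDiffOn_pd1.differentiableOn one_ne_zero)) hp'
    have h2 := (eqOn_pd2 (pd2_sub hw.differentiableOn hv.differentiableOn)).trans
      (pd2_sub (hw.contDiffOn_pd2.differentiableOn one_ne_zero)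
        (hv.contDiffOn_pd2.differentiableOn one_ne_zero)) hp'
    rw [h1, h2, ← hw.equation p hp, ← hv.equation p hp]
    ring
  robin x := by
    rw [pd2_sub hw.differentiableOn hv.differentiableOn (x := (x, 0)) (le_refl (0 : ℝ))]
    linear_combination hw.robin x - hv.robin x
  orthogonal x := by
    obtain ⟨h1, h2⟩ := hw.orthogonal x
    obtain ⟨h3, h4⟩ := hv.orthogonal x
    simp only [sub_mul]
    exact ⟨h1.sub h3, by rw [integral_sub h1 h3, h2, h4, sub_zero]⟩
  integrable_weight := integrable_mul_norm_sub_sq (fun p => by positivity)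
    (Measurable.aestronglyMeasurable (by fun_prop)) hw.integrable_weight hv.integrable_weight
    (aestronglyMeasurable_upperHalf (hw.contDiffOn.continuousOn.sub hv.contDiffOn.continuousOn))
  integrable_pd1 := by
    refine IntegrableOn.congr_fun (integrable_norm_sub_sq hw.integrable_pd1 hv.integrable_pd1
      (aestronglyMeasurable_upperHalf
        (hw.contDiffOn_pd1.continuousOn.sub hv.contDiffOn_pd1.continuousOn)))
      (fun p hp => ?_) measurableSet_upperHalf
    rw [pd1_sub hw.differentiableOn hv.differentiableOn (upperHalf_subset_closedHalf hp)]
  integrable_pd2 := by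
    refine IntegrableOn.congr_fun (integrable_norm_sub_sq hw.integrable_pd2 hv.integrable_pd2
      (aestronglyMeasurable_upperHalf
        (hw.contDiffOn_pd2.continuousOn.sub hv.contDiffOn_pd2.continuousOn)))
      (fun p hp => ?_) measurableSet_upperHalf
    rw [pd2_sub hw.differentiableOn hv.differentiableOn (upperHalf_subset_closedHalf hp)]
  integrable_trace := by
    have hc : ∀ {u : ℝ × ℝ → ℂ}, ContinuousOn u closedHalf → Continuous fun x : ℝ => u (x, 0) :=
      fun hu => hu.comp_continuous (by fun_prop) fun _ => le_refl (0 : ℝ)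
    exact integrable_norm_sub_sq hw.integrable_trace hv.integrable_trace
      ((hc hw.contDiffOn.continuousOn).sub (hc hv.contDiffOn.continuousOn)).aestronglyMeasurable
  integrable_source := integrable_mul_norm_sub_sq (fun p => by positivity)
    (Measurable.aestronglyMeasurable (by fun_prop)) hw.integrable_source hv.integrable_source
    ((hw.continuousOn_source.sub hv.continuousOn_source).aestronglyMeasurable
      measurableSet_upperHalf)
  integrable_absorption := by
    have hm := aestronglyMeasurable_upperHalf
      (hw.contDiffOn.continuousOn.sub hv.contDiffOn.continuousOn)
    have h1 := integrable_mul_norm_sub_sq (c := fun _ => |ε|) (fun p => abs_nonneg ε)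
      aestronglyMeasurable_const
      (by simpa [abs_mul] using hw.integrable_absorption.abs)
      (by simpa [abs_mul] using hv.integrable_absorption.abs) hm
    exact h1.mono' ((hm.norm.pow 2).const_mul ε) (Filter.Eventually.of_forall fun p => by simp)

end IsEnergySolution

lemma norm_increment_sq_le {φ φ' : ℝ → ℂ} (hd : ∀ s, HasDerivAt φ (φ' s) s)
    (hc : Continuous φ') (x h : ℝ) :
    ‖φ (x + h) - φ x‖ ^ 2 ≤ h ^ 2 * ∫ s in Ioc (0 : ℝ) 1, ‖φ' (x + s * h)‖ ^ 2 := by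
  have hc1 : Continuous fun s : ℝ => φ' (x + s * h) := hc.comp (by fun_prop)
  have h1 : ∫ s in (0 : ℝ)..1, h • φ' (x + s * h) = φ (x + h) - φ x := by
    have hd1 : ∀ s ∈ uIcc (0 : ℝ) 1,
        HasDerivAt (fun s : ℝ => φ (x + s * h)) (h • φ' (x + s * h)) s := fun s _ => by
      have h2 : HasDerivAt (fun s : ℝ => x + s * h) h s := by
        simpa using ((hasDerivAt_id s).mul_const h).const_add x
      exact (hd (x + s * h)).scomp s h2
    rw [intervalIntegral.integral_eq_sub_of_hasDerivAt hd1
      ((hc1.const_smul h).intervalIntegrable 0 1)]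
    simp
  have h2 : ‖φ (x + h) - φ x‖ ≤ |h| * ∫ s in (0 : ℝ)..1, ‖φ' (x + s * h)‖ := by
    rw [← h1, intervalIntegral.integral_smul, norm_smul, Real.norm_eq_abs]
    exact mul_le_mul_of_nonneg_left
      (intervalIntegral.norm_integral_le_integral_norm zero_le_one) (abs_nonneg h)
  rw [← intervalIntegral.integral_of_le zero_le_one]
  set I := ∫ s in (0 : ℝ)..1, ‖φ' (x + s * h)‖ with hI
  have h3 : 0 ≤ ∫ s in (0 : ℝ)..1, (‖φ' (x + s * h)‖ - I) ^ 2 :=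
    intervalIntegral.integral_nonneg zero_le_one fun s _ => sq_nonneg _
  have h4 : ∫ s in (0 : ℝ)..1, (‖φ' (x + s * h)‖ - I) ^ 2
      = (∫ s in (0 : ℝ)..1, ‖φ' (x + s * h)‖ ^ 2) - I ^ 2 := by
    have e : (fun s : ℝ => (‖φ' (x + s * h)‖ - I) ^ 2)
        = fun s => (‖φ' (x + s * h)‖ ^ 2 - 2 * I * ‖φ' (x + s * h)‖) + I ^ 2 := by
      ext s; ring
    rw [e, intervalIntegral.integral_add, intervalIntegral.integral_sub,
      intervalIntegral.integral_const_mul, ← hI]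
    · simp
      ring
    all_goals exact Continuous.intervalIntegrable (by fun_prop) 0 1
  calc ‖φ (x + h) - φ x‖ ^ 2 ≤ (|h| * I) ^ 2 := by gcongr
    _ = h ^ 2 * I ^ 2 := by rw [mul_pow, sq_abs]
    _ ≤ _ := mul_le_mul_of_nonneg_left (by linarith) (sq_nonneg h)

/-- The `L²` norm of a horizontal difference is controlled by that of the horizontal
derivative. -/
lemma integral_norm_shift_sub_sq_le {g : ℝ × ℝ → ℂ} (hg : DifferentiableOn ℝ g closedHalf)
    (hc : ContinuousOn (pd1 g) closedHalf)
    (hi : IntegrableOn (fun p => ‖pd1 g p‖ ^ 2) upperHalf) (h : ℝ) :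
    IntegrableOn (fun p => ‖g (p.1 + h, p.2) - g p‖ ^ 2) upperHalf ∧
      ∫ p in upperHalf, ‖g (p.1 + h, p.2) - g p‖ ^ 2
        ≤ h ^ 2 * ∫ p in upperHalf, ‖pd1 g p‖ ^ 2 := by
  set Ψ : (ℝ × ℝ) × ℝ → ℝ := fun q => ‖pd1 g (q.1.1 + q.2 * h, q.1.2)‖ ^ 2 with hΨ
  have hΨm : AEStronglyMeasurable Ψ
      ((volume.restrict upperHalf).prod (volume.restrict (Ioc (0 : ℝ) 1))) := by
    rw [Measure.prod_restrict]
    refine ContinuousOn.aestronglyMeasurable ?_ (measurableSet_upperHalf.prod measurableSet_Ioc)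
    exact (hc.comp (f := fun q : (ℝ × ℝ) × ℝ => (q.1.1 + q.2 * h, q.1.2)) (by fun_prop)
      fun q hq => upperHalf_subset_closedHalf hq.1).norm.pow 2
  have hslice : ∀ s : ℝ, ∫ p in upperHalf, Ψ (p, s) = ∫ p in upperHalf, ‖pd1 g p‖ ^ 2 := fun s =>
    integral_shift (fun p => ‖pd1 g p‖ ^ 2) (s * h)
  have hΨi : Integrable Ψ
      ((volume.restrict upperHalf).prod (volume.restrict (Ioc (0 : ℝ) 1))) := by
    refine (integrable_prod_iff' hΨm).2 ⟨Filter.Eventually.of_forall fun s =>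
      integrableOn_shift hi (s * h), ?_⟩
    have : (fun s => ∫ p in upperHalf, ‖Ψ (p, s)‖)
        = fun _ => ∫ p in upperHalf, ‖pd1 g p‖ ^ 2 := by
      ext s
      rw [← hslice s]
      exact integral_congr_ae (Filter.Eventually.of_forall fun p => by simp [hΨ])
    rw [this]
    exact integrable_const _
  have hpt : ∀ p ∈ upperHalf, ‖g (p.1 + h, p.2) - g p‖ ^ 2
      ≤ h ^ 2 * ∫ s in Ioc (0 : ℝ) 1, Ψ (p, s) := fun p hp =>
    norm_increment_sq_le (φ := fun s => g (s, p.2)) (φ' := fun s => pd1 g (s, p.2))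
      (fun s => hasDerivAt_pd1 hg (p := (s, p.2)) (upperHalf_subset_closedHalf hp))
      (hc.comp_continuous (by fun_prop) fun _ => upperHalf_subset_closedHalf hp) p.1 h
  have hint := hΨi.integral_prod_left.const_mul (h ^ 2)
  have hcs : ContinuousOn (fun p => g (p.1 + h, p.2)) closedHalf :=
    hg.continuousOn.comp (by fun_prop) fun _ hp => hp
  have hi2 : IntegrableOn (fun p => ‖g (p.1 + h, p.2) - g p‖ ^ 2) upperHalf := by
    refine hint.mono'
      ((aestronglyMeasurable_upperHalf (hcs.sub hg.continuousOn)).norm.pow 2) ?_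
    filter_upwards [ae_restrict_mem measurableSet_upperHalf] with p hp
    rw [Real.norm_of_nonneg (by positivity)]
    exact hpt p hp
  refine ⟨hi2, (setIntegral_mono_on hi2 hint measurableSet_upperHalf hpt).trans ?_⟩
  rw [integral_const_mul, integral_integral_swap hΨi]
  simp [hslice]

namespace IsEnergySolution

variable {ν ε : ℝ} {w f : ℝ × ℝ → ℂ}

/-- Energy bound for the horizontal difference of a solution. -/
lemma difference_le (hw : IsEnergySolution ν ε w f) (hν : 0 < ν) {h : ℝ} (hh : 0 < h) :
    (∫ p in upperHalf, ‖pd1 w (p.1 + h, p.2) - pd1 w p‖ ^ 2)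
        + (∫ p in upperHalf, ‖pd2 w (p.1 + h, p.2) - pd2 w p‖ ^ 2)
      ≤ h ^ 2 * ∫ p in upperHalf, ‖f p‖ ^ 2 := by
  have hD := (hw.shift h).sub hw
  set D : ℝ × ℝ → ℂ := fun p => w (p.1 + h, p.2) - w p with hDdef
  have hcoer := hD.coercive hν
  have e1 : ∫ p in upperHalf, ‖pd1 D p‖ ^ 2
      = ∫ p in upperHalf, ‖pd1 w (p.1 + h, p.2) - pd1 w p‖ ^ 2 := by
    refine setIntegral_congr_fun measurableSet_upperHalf fun p hp => ?_
    have := pd1_sub (hw.shift h).differentiableOn hw.differentiableOn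
      (upperHalf_subset_closedHalf hp)
    rw [pd1_shift] at this
    simp only [hDdef, this]
  have e2 : ∫ p in upperHalf, ‖pd2 D p‖ ^ 2
      = ∫ p in upperHalf, ‖pd2 w (p.1 + h, p.2) - pd2 w p‖ ^ 2 := by
    refine setIntegral_congr_fun measurableSet_upperHalf fun p hp => ?_
    have := pd2_sub (hw.shift h).differentiableOn hw.differentiableOn
      (upperHalf_subset_closedHalf hp)
    rw [pd2_shift] at this
    simp only [hDdef, this]
  rw [← e1, ← e2]
  have hfs := (hw.shift h).continuousOn_source
  have i1 : IntegrableOn (fun p => star (D p) * f (p.1 + h, p.2)) upperHalf :=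
    integrableOn_star_mul hD.contDiffOn.continuousOn hfs hD.integrable_weight
      (hw.shift h).integrable_source
  have i2 : IntegrableOn (fun p => star (D p) * f p) upperHalf :=
    integrableOn_star_mul hD.contDiffOn.continuousOn hw.continuousOn_source hD.integrable_weight
      hw.integrable_source
  have i3 : IntegrableOn (fun p => star (D (p.1 + -h, p.2)) * f p) upperHalf := by
    simpa using integrableOn_shift i1 (-h)
  have e3 : ∫ p in upperHalf, star (D p) * f (p.1 + h, p.2)
      = ∫ p in upperHalf, star (D (p.1 + -h, p.2)) * f p := by
    rw [← integral_shift _ (-h)]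
    simp
  have e4 : ∫ p in upperHalf, star (D p) * (f (p.1 + h, p.2) - f p)
      = ∫ p in upperHalf, star (D (p.1 + -h, p.2) - D p) * f p := by
    simp only [mul_sub, star_sub, sub_mul]
    rw [integral_sub i1 i2, integral_sub i3 i2, e3]
  obtain ⟨j1, j2⟩ := integral_norm_shift_sub_sq_le hD.differentiableOn
    hD.contDiffOn_pd1.continuousOn hD.integrable_pd1 (-h)
  obtain ⟨j3, -⟩ := hw.integrable_norm_sq_source
  have hb : ‖∫ p in upperHalf, star (D (p.1 + -h, p.2) - D p) * f p‖
      ≤ 1 / (2 * h ^ 2) * (∫ p in upperHalf, ‖D (p.1 + -h, p.2) - D p‖ ^ 2)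
        + h ^ 2 / 2 * ∫ p in upperHalf, ‖f p‖ ^ 2 := by
    rw [← integral_const_mul, ← integral_const_mul,
      ← integral_add (j1.const_mul _) (j3.const_mul _)]
    refine norm_integral_le_of_norm_le ((j1.const_mul _).add (j3.const_mul _))
      (Filter.Eventually.of_forall fun p => ?_)
    rw [norm_mul, norm_star]
    set a := ‖D (p.1 + -h, p.2) - D p‖
    set b := ‖f p‖
    have h1 : 1 / (2 * h ^ 2) * a ^ 2 + h ^ 2 / 2 * b ^ 2 - a * b
        = (a / h - h * b) ^ 2 / 2 := by field_simp; ring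
    have h2 := sq_nonneg (a / h - h * b)
    linarith
  rw [e4] at hcoer
  have h5 := (abs_le.1 ((Complex.abs_re_le_norm _).trans hb)).1
  have h6 := mul_le_mul_of_nonneg_left j2 (show 0 ≤ 1 / (2 * h ^ 2) by positivity)
  have h7 : 1 / (2 * h ^ 2) * ((-h) ^ 2 * ∫ p in upperHalf, ‖pd1 D p‖ ^ 2)
      = (∫ p in upperHalf, ‖pd1 D p‖ ^ 2) / 2 := by field_simp
  linarith

end IsEnergySolution

lemma tendsto_differenceQuotient_norm_sq {g : ℝ × ℝ → ℂ} (hg : DifferentiableOn ℝ g closedHalf)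
    {p : ℝ × ℝ} (hp : p ∈ closedHalf) :
    Filter.Tendsto (fun t : ℝ => (t ^ 2)⁻¹ * ‖g (p.1 + t, p.2) - g p‖ ^ 2)
      (nhdsWithin 0 (Ioi 0)) (nhds (‖pd1 g p‖ ^ 2)) := by
  refine ((hasDerivAt_pd1 hg hp).tendsto_slope_zero_right.norm.pow 2).congr fun t => ?_
  rw [norm_smul, mul_pow, norm_inv, Real.norm_eq_abs, inv_pow, sq_abs]

namespace IsEnergySolution

variable {ν ε : ℝ} {w f : ℝ × ℝ → ℂ}

/-- Tangential second-order estimate, by passing to the limit in difference quotients. -/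
lemma tangential_le (hw : IsEnergySolution ν ε w f) (hν : 0 < ν)
    (hi : IntegrableOn (fun p => ‖pd1 (pd1 w) p‖ ^ 2 + ‖pd1 (pd2 w) p‖ ^ 2) upperHalf) :
    ∫ p in upperHalf, (‖pd1 (pd1 w) p‖ ^ 2 + ‖pd1 (pd2 w) p‖ ^ 2)
      ≤ ∫ p in upperHalf, ‖f p‖ ^ 2 := by
  have hd1 := hw.contDiffOn_pd1.differentiableOn one_ne_zero
  have hd2 := hw.contDiffOn_pd2.differentiableOn one_ne_zero
  have hsub : ∀ {g : ℝ × ℝ → ℂ}, ContinuousOn g closedHalf → ∀ t : ℝ,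
      AEStronglyMeasurable (fun p => g (p.1 + t, p.2) - g p) (volume.restrict upperHalf) :=
    fun hg t => aestronglyMeasurable_upperHalf
      ((hg.comp (f := fun p : ℝ × ℝ => (p.1 + t, p.2)) (by fun_prop) fun _ hp => hp).sub hg)
  set Q : ℝ → ℝ × ℝ → ℝ := fun t p =>
    (t ^ 2)⁻¹ * ‖pd1 w (p.1 + t, p.2) - pd1 w p‖ ^ 2
      + (t ^ 2)⁻¹ * ‖pd2 w (p.1 + t, p.2) - pd2 w p‖ ^ 2 with hQ
  have hQm : ∀ t, AEStronglyMeasurable (Q t) (volume.restrict upperHalf) := fun t =>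
    (((hsub hd1.continuousOn t).norm.pow 2).const_mul _).add
      (((hsub hd2.continuousOn t).norm.pow 2).const_mul _)
  have hQle : ∀ t, 0 < t → ∫⁻ p in upperHalf, ENNReal.ofReal (Q t p)
      ≤ ENNReal.ofReal (∫ p in upperHalf, ‖f p‖ ^ 2) := fun t ht => by
    have i1 := (integrable_norm_sub_sq (integrableOn_shift hw.integrable_pd1 t)
      hw.integrable_pd1 (hsub hd1.continuousOn t)).const_mul (t ^ 2)⁻¹
    have i2 := (integrable_norm_sub_sq (integrableOn_shift hw.integrable_pd2 t)
      hw.integrable_pd2 (hsub hd2.continuousOn t)).const_mul (t ^ 2)⁻¹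
    have hQi : Integrable (Q t) (volume.restrict upperHalf) := i1.add i2
    rw [← ofReal_integral_eq_lintegral_ofReal hQi
      (Filter.Eventually.of_forall fun p => by simp only [Pi.zero_apply]; positivity)]
    refine ENNReal.ofReal_le_ofReal ?_
    simp only [hQ]
    rw [integral_add i1 i2, integral_const_mul, integral_const_mul, ← mul_add,
      inv_mul_le_iff₀ (by positivity)]
    exact hw.difference_le hν ht
  set τ : ℕ → ℝ := fun n => 1 / ((n : ℝ) + 1) with hτ
  have hτ0 : ∀ n, 0 < τ n := fun n => by positivity
  have hτl : Filter.Tendsto τ Filter.atTop (nhdsWithin 0 (Ioi 0)) :=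
    tendsto_nhdsWithin_iff.2
      ⟨tendsto_one_div_add_atTop_nhds_zero_nat, Filter.Eventually.of_forall hτ0⟩
  have hlim : ∀ p ∈ upperHalf, Filter.Tendsto (fun n => ENNReal.ofReal (Q (τ n) p)) Filter.atTop
      (nhds (ENNReal.ofReal (‖pd1 (pd1 w) p‖ ^ 2 + ‖pd1 (pd2 w) p‖ ^ 2))) := fun p hp =>
    ENNReal.tendsto_ofReal
      (((tendsto_differenceQuotient_norm_sq hd1 (upperHalf_subset_closedHalf hp)).add
        (tendsto_differenceQuotient_norm_sq hd2 (upperHalf_subset_closedHalf hp))).comp hτl)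
  have hF0 : 0 ≤ ∫ p in upperHalf, ‖f p‖ ^ 2 := integral_nonneg fun p => by positivity
  rw [← ENNReal.ofReal_le_ofReal_iff hF0, ofReal_integral_eq_lintegral_ofReal hi
    (Filter.Eventually.of_forall fun p => by simp only [Pi.zero_apply]; positivity)]
  calc ∫⁻ p in upperHalf, ENNReal.ofReal (‖pd1 (pd1 w) p‖ ^ 2 + ‖pd1 (pd2 w) p‖ ^ 2)
      = ∫⁻ p in upperHalf,
          Filter.liminf (fun n => ENNReal.ofReal (Q (τ n) p)) Filter.atTop :=
        setLIntegral_congr_fun measurableSet_upperHalf fun p hp => (hlim p hp).liminf_eq.symm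
    _ ≤ Filter.liminf (fun n => ∫⁻ p in upperHalf, ENNReal.ofReal (Q (τ n) p)) Filter.atTop :=
        lintegral_liminf_le' fun n => (hQm (τ n)).aemeasurable.ennreal_ofReal
    _ ≤ Filter.liminf (fun _ : ℕ => ENNReal.ofReal (∫ p in upperHalf, ‖f p‖ ^ 2))
          Filter.atTop :=
        Filter.liminf_le_liminf (Filter.Eventually.of_forall fun n => hQle (τ n) (hτ0 n))
    _ = _ := Filter.liminf_const _

lemma norm_sq_pd2_pd2_le (hw : IsEnergySolution ν ε w f) {p : ℝ × ℝ} (hp : p ∈ upperHalf) :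
    ‖pd2 (pd2 w) p‖ ^ 2 ≤ 3 * (‖f p‖ ^ 2 + ε ^ 2 * ‖w p‖ ^ 2 + ‖pd1 (pd1 w) p‖ ^ 2) := by
  have e : pd2 (pd2 w) p = f p + Complex.I * ε * w p - pd1 (pd1 w) p := by
    linear_combination hw.equation p hp
  have h1 : ‖pd2 (pd2 w) p‖ ≤ ‖f p‖ + |ε| * ‖w p‖ + ‖pd1 (pd1 w) p‖ := by
    rw [e]
    refine (norm_sub_le _ _).trans (add_le_add_left ((norm_add_le _ _).trans_eq ?_) _)
    simp
  rw [← sq_abs ε]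
  nlinarith [norm_nonneg (pd2 (pd2 w) p), sq_nonneg (‖f p‖ - |ε| * ‖w p‖),
    sq_nonneg (‖f p‖ - ‖pd1 (pd1 w) p‖), sq_nonneg (|ε| * ‖w p‖ - ‖pd1 (pd1 w) p‖)]

lemma second_order_le (hw : IsEnergySolution ν ε w f) (hν : 0 < ν)
    (hi : IntegrableOn (fun p =>
      ‖pd1 (pd1 w) p‖ ^ 2 + ‖pd1 (pd2 w) p‖ ^ 2 + ‖pd2 (pd2 w) p‖ ^ 2) upperHalf) :
    ∫ p in upperHalf, (‖pd1 (pd1 w) p‖ ^ 2 + ‖pd1 (pd2 w) p‖ ^ 2 + ‖pd2 (pd2 w) p‖ ^ 2)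
      ≤ 10 * ∫ p in upperHalf, ‖f p‖ ^ 2 := by
  have hm1 := (aestronglyMeasurable_upperHalf
    (_root_.contDiffOn_pd1 (m := 0) hw.contDiffOn_pd1 (by norm_num)).continuousOn).norm.pow 2
  have hm2 := (aestronglyMeasurable_upperHalf
    (_root_.contDiffOn_pd1 (m := 0) hw.contDiffOn_pd2 (by norm_num)).continuousOn).norm.pow 2
  have ht : IntegrableOn (fun p => ‖pd1 (pd1 w) p‖ ^ 2 + ‖pd1 (pd2 w) p‖ ^ 2) upperHalf := by
    refine hi.mono' (hm1.add hm2) (Filter.Eventually.of_forall fun p => ?_)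
    rw [Real.norm_of_nonneg (by positivity)]
    exact le_add_of_nonneg_right (by positivity)
  obtain ⟨hf, -⟩ := hw.integrable_norm_sq_source
  obtain ⟨ha, hale⟩ := hw.absorption_le
  have htle := hw.tangential_le hν ht
  have hbound : ∀ p ∈ upperHalf,
      ‖pd1 (pd1 w) p‖ ^ 2 + ‖pd1 (pd2 w) p‖ ^ 2 + ‖pd2 (pd2 w) p‖ ^ 2
        ≤ 3 * (‖f p‖ ^ 2 + ε ^ 2 * ‖w p‖ ^ 2)
          + 4 * (‖pd1 (pd1 w) p‖ ^ 2 + ‖pd1 (pd2 w) p‖ ^ 2) := fun p hp => by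
    have := hw.norm_sq_pd2_pd2_le hp
    nlinarith [sq_nonneg ‖pd1 (pd2 w) p‖]
  refine (setIntegral_mono_on hi (((hf.add ha).const_mul 3).add (ht.const_mul 4))
    measurableSet_upperHalf hbound).trans ?_
  have e := integral_add ((hf.add ha).const_mul 3) (ht.const_mul 4)
  simp only [Pi.add_apply] at e ⊢
  rw [e, integral_const_mul, integral_const_mul, integral_add hf ha]
  linarith

end IsEnergySolution

/-- Uniform second-order estimate for the projected part of the solution: there is an
absolute constant `c`, independent of `ε, ν, w, f`, such that whenever `Δw − iεw = f` in
`ℝ²₊`, `−∂₂w = νw` on `{x₂ = 0}`, each fibre of `w` is orthogonal to `e^{−νx₂}`, and the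
listed integrals are finite, then
`∫ Σ_{|δ|=2}|∂^δw|² + ∫ (1+x₂)^{−2}|w|² ≤ c ((1+ν²)/ν²) ∫ (1+x₂)²|f|²`. -/
theorem projected_second_order_estimate :
    ∃ c : ℝ, 0 < c ∧ ∀ (ν ε : ℝ) (w f : ℝ × ℝ → ℂ),
      0 < ν → |ε| ≤ 1 →
      ContDiffOn ℝ 2 w {p : ℝ × ℝ | 0 ≤ p.2} →
      (∀ p ∈ upperHalf, pd1 (pd1 w) p + pd2 (pd2 w) p - Complex.I * ε * w p = f p) →
      (∀ x₁ : ℝ, -pd2 w (x₁, 0) = ν * w (x₁, 0)) →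
      (∀ x₁ : ℝ, IntegrableOn (fun t : ℝ => w (x₁, t) * Complex.exp (-(ν : ℂ) * t))
          (Ioi (0 : ℝ)) ∧
        ∫ t in Ioi (0 : ℝ), w (x₁, t) * Complex.exp (-(ν : ℂ) * t) = 0) →
      IntegrableOn (fun p : ℝ × ℝ => ((1 + p.2) ^ 2)⁻¹ * ‖w p‖ ^ 2) upperHalf →
      IntegrableOn (fun p : ℝ × ℝ => ‖pd1 w p‖ ^ 2 + ‖pd2 w p‖ ^ 2) upperHalf →
      IntegrableOn (fun p : ℝ × ℝ =>
          ‖pd1 (pd1 w) p‖ ^ 2 + ‖pd1 (pd2 w) p‖ ^ 2 + ‖pd2 (pd2 w) p‖ ^ 2) upperHalf →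
      Integrable (fun x₁ : ℝ => ‖w (x₁, 0)‖ ^ 2) →
      IntegrableOn (fun p : ℝ × ℝ => (1 + p.2) ^ 2 * ‖f p‖ ^ 2) upperHalf →
      (∫ p in upperHalf,
            (‖pd1 (pd1 w) p‖ ^ 2 + ‖pd1 (pd2 w) p‖ ^ 2 + ‖pd2 (pd2 w) p‖ ^ 2))
        + (∫ p in upperHalf, ((1 + p.2) ^ 2)⁻¹ * ‖w p‖ ^ 2) ≤
      c * ((1 + ν ^ 2) / ν ^ 2) * ∫ p in upperHalf, (1 + p.2) ^ 2 * ‖f p‖ ^ 2 := by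
  refine ⟨138, by norm_num, fun ν ε w f hν _ hw heq hrob horth hwt hgrad hsec htr hf => ?_⟩
  have hc1 : ContDiffOn ℝ 1 (pd1 w) closedHalf := contDiffOn_pd1 hw (by norm_num)
  have hc2 : ContDiffOn ℝ 1 (pd2 w) closedHalf := contDiffOn_pd2 hw (by norm_num)
  have hc11 := (contDiffOn_pd1 (m := 0) hc1 (by norm_num)).continuousOn
  have hc22 := (contDiffOn_pd2 (m := 0) hc2 (by norm_num)).continuousOn
  have hwc : ContinuousOn w closedHalf := hw.continuousOn
  have hi1 : IntegrableOn (fun p => ‖pd1 w p‖ ^ 2) upperHalf := by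
    refine hgrad.mono' ((aestronglyMeasurable_upperHalf hc1.continuousOn).norm.pow 2)
      (Filter.Eventually.of_forall fun p => ?_)
    rw [Real.norm_of_nonneg (by positivity)]
    exact le_add_of_nonneg_right (by positivity)
  have hi2 : IntegrableOn (fun p => ‖pd2 w p‖ ^ 2) upperHalf := by
    refine hgrad.mono' ((aestronglyMeasurable_upperHalf hc2.continuousOn).norm.pow 2)
      (Filter.Eventually.of_forall fun p => ?_)
    rw [Real.norm_of_nonneg (by positivity)]
    exact le_add_of_nonneg_left (by positivity)
  have habs : IntegrableOn (fun p => ε * ‖w p‖ ^ 2) upperHalf := by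
    rcases eq_or_ne ε 0 with rfl | hε
    · simp
    have hε' : 0 < |ε| := abs_pos.2 hε
    refine ((hsec.add hf).const_mul (3 / |ε|)).mono'
      (((aestronglyMeasurable_upperHalf hwc).norm.pow 2).const_mul ε) ?_
    filter_upwards [ae_restrict_mem measurableSet_upperHalf] with p hp
    have h0 : 0 < p.2 := hp
    have e : Complex.I * ε * w p = pd1 (pd1 w) p + pd2 (pd2 w) p - f p := by
      linear_combination -heq p hp
    have h1 : |ε| * ‖w p‖ ≤ ‖pd1 (pd1 w) p‖ + ‖pd2 (pd2 w) p‖ + ‖f p‖ := by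
      have : |ε| * ‖w p‖ = ‖Complex.I * ε * w p‖ := by simp
      rw [this, e]
      exact (norm_sub_le _ _).trans (add_le_add_left (norm_add_le _ _) _)
    have h2 : ‖f p‖ ^ 2 ≤ (1 + p.2) ^ 2 * ‖f p‖ ^ 2 :=
      le_mul_of_one_le_left (by positivity) (by nlinarith)
    have h3 : (|ε| * ‖w p‖) ^ 2 ≤ 3 * ((‖pd1 (pd1 w) p‖ ^ 2 + ‖pd1 (pd2 w) p‖ ^ 2
        + ‖pd2 (pd2 w) p‖ ^ 2) + (1 + p.2) ^ 2 * ‖f p‖ ^ 2) := by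
      have h4 : (|ε| * ‖w p‖) ^ 2 ≤ (‖pd1 (pd1 w) p‖ + ‖pd2 (pd2 w) p‖ + ‖f p‖) ^ 2 := by gcongr
      nlinarith [sq_nonneg (‖pd1 (pd1 w) p‖ - ‖pd2 (pd2 w) p‖),
        sq_nonneg (‖pd1 (pd1 w) p‖ - ‖f p‖), sq_nonneg (‖pd2 (pd2 w) p‖ - ‖f p‖),
        sq_nonneg ‖pd1 (pd2 w) p‖]
    rw [norm_mul, norm_pow, norm_norm, Real.norm_eq_abs, div_mul_eq_mul_div, le_div_iff₀ hε']
    simp only [Pi.add_apply]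
    linarith
  have h : IsEnergySolution ν ε w f :=
    ⟨hw, heq, hrob, horth, hwt, hi1, hi2, htr, hf, habs⟩
  have h1 := h.second_order_le hν hsec
  have h2 := h.weighted_le hν
  have h3 := h.integrable_norm_sq_source.2
  have h4 : 1 ≤ (1 + ν ^ 2) / ν ^ 2 := by
    rw [one_le_div (by positivity)]
    linarith
  have h5 : 0 ≤ ∫ p in upperHalf, (1 + p.2) ^ 2 * ‖f p‖ ^ 2 :=
    integral_nonneg fun p => by positivity
  have h6 := mul_le_mul_of_nonneg_right h4 h5
  linarith
end

section
/- Let ν > 0 and let u : ℝ × [0,∞) → ℂ be twice continuously differentiable such that: (i) for every compact K ⊂ ℝ there exist C_K > 0 and γ_K < ν with |u| + |∂₁u| + |∂₁²u| + |∂₂u| + |∂₂²u| ≤ C_K e^{γ_K x₂} for all x₁ ∈ K and x₂ ≥ 0; (ii) −∂_{x₂}u(x₁,0) = ν u(x₁,0) for every x₁ ∈ ℝ. Define w(x₁) = 2ν ∫₀^∞ u(x₁,x₂) e^{−νx₂} dx₂. Then w is twice continuously differentiable and for every x₁ ∈ ℝ, w″(x₁) + ν² w(x₁) = 2ν ∫₀^∞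 (Δu)(x₁,x₂) e^{−νx₂} dx₂. In particular, if Δu − iεu = F on {x₂ > 0} for some ε ∈ ℝ, then w″(x₁) + (ν² − iε) w(x₁) = 2ν ∫₀^∞ F(x₁,x₂) e^{−νx₂} dx₂. -/
open Set MeasureTheory

/-- The closed upper half-plane `ℝ × [0,∞)`. -/
def closedUpperHalf : Set (ℝ × ℝ) := {p : ℝ × ℝ | 0 ≤ p.2}

lemma uniqueDiffOn_closedUpperHalf : UniqueDiffOn ℝ closedUpperHalf := by
  have h : closedUpperHalf = univ ×ˢ Ici (0 : ℝ) := by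
    ext p; simp [closedUpperHalf]
  rw [h]
  exact uniqueDiffOn_univ.prod (uniqueDiffOn_Ici 0)

/-- `f` grows at most like `e^{γx₂}` with `γ < ν`, locally uniformly in `x₁`. -/
def LocallyExpBounded (ν : ℝ) (f : ℝ × ℝ → ℂ) : Prop :=
  ∀ K : Set ℝ, IsCompact K → ∃ C γ : ℝ, γ < ν ∧
    ∀ x ∈ K, ∀ t : ℝ, 0 ≤ t → ‖f (x, t)‖ ≤ C * Real.exp (γ * t)

/-- The weighted integral `∫₀^∞ f(x,t)e^{−νt} dt`. -/
noncomputable def expIntegral (ν : ℝ) (f : ℝ × ℝ → ℂ) (x : ℝ) : ℂ :=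
  ∫ t in Ioi (0 : ℝ), f (x, t) * Complex.exp (-(ν : ℂ) * t)

section Partial

variable {f : ℝ × ℝ → ℂ}

lemma hasDerivAt_fst_slice_s11 (hf : DifferentiableOn ℝ f closedUpperHalf) (x : ℝ) {t : ℝ}
    (ht : 0 ≤ t) :
    HasDerivAt (fun s => f (s, t)) (fderivWithin ℝ f closedUpperHalf (x, t) (1, 0)) x := by
  have h1 : HasDerivWithinAt (fun s : ℝ => (s, t)) ((1 : ℝ), (0 : ℝ)) univ x :=
    ((hasDerivAt_id x).prodMk (hasDerivAt_const x t)).hasDerivWithinAt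
  have h2 := (hf (x, t) ht).hasFDerivWithinAt.comp_hasDerivWithinAt x h1 (fun _ _ => ht)
  exact hasDerivWithinAt_univ.1 h2

lemma hasDerivWithinAt_snd_slice_s11 (hf : DifferentiableOn ℝ f closedUpperHalf) (x : ℝ) {t : ℝ}
    (ht : 0 ≤ t) :
    HasDerivWithinAt (fun s => f (x, s)) (fderivWithin ℝ f closedUpperHalf (x, t) (0, 1))
      (Ici 0) t := by
  have h1 : HasDerivWithinAt (fun s : ℝ => (x, s)) ((0 : ℝ), (1 : ℝ)) (Ici 0) t :=
    ((hasDerivAt_const t x).prodMk (hasDerivAt_id t)).hasDerivWithinAt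
  exact (hf (x, t) ht).hasFDerivWithinAt.comp_hasDerivWithinAt t h1 (fun _ hs => hs)

lemma pd1_eq_fderivWithin_s11 (hf : DifferentiableOn ℝ f closedUpperHalf) :
    EqOn (pd1 f) (fun p => fderivWithin ℝ f closedUpperHalf p (1, 0)) closedUpperHalf :=
  fun p hp => (hasDerivAt_fst_slice_s11 hf p.1 hp).deriv

lemma pd2_eq_fderivWithin_s11 (hf : DifferentiableOn ℝ f closedUpperHalf) :
    EqOn (pd2 f) (fun p => fderivWithin ℝ f closedUpperHalf p (0, 1)) closedUpperHalf :=
  fun p hp => (hasDerivWithinAt_snd_slice_s11 hf p.1 hp).derivWithin (uniqueDiffOn_Ici 0 _ hp)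

lemma hasDerivAt_pd1_s11 (hf : DifferentiableOn ℝ f closedUpperHalf) (x : ℝ) {t : ℝ}
    (ht : 0 ≤ t) : HasDerivAt (fun s => f (s, t)) (pd1 f (x, t)) x := by
  have hp : (x, t) ∈ closedUpperHalf := ht
  rw [pd1_eq_fderivWithin_s11 hf hp]
  exact hasDerivAt_fst_slice_s11 hf x ht

lemma hasDerivAt_pd2_s11 (hf : DifferentiableOn ℝ f closedUpperHalf) (x : ℝ) {t : ℝ}
    (ht : 0 < t) : HasDerivAt (fun s => f (x, s)) (pd2 f (x, t)) t := by
  have hp : (x, t) ∈ closedUpperHalf := ht.le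
  rw [pd2_eq_fderivWithin_s11 hf hp]
  exact (hasDerivWithinAt_snd_slice_s11 hf x ht.le).hasDerivAt (Ici_mem_nhds ht)

lemma ContDiffOn.pd1 {m n : WithTop ℕ∞} (hf : ContDiffOn ℝ n f closedUpperHalf)
    (hmn : m + 1 ≤ n) : ContDiffOn ℝ m (pd1 f) closedUpperHalf :=
  ((hf.fderivWithin uniqueDiffOn_closedUpperHalf hmn).clm_apply contDiffOn_const).congr
    (pd1_eq_fderivWithin_s11 ((hf.of_le hmn).differentiableOn (by simp)))

lemma ContDiffOn.pd2 {m n : WithTop ℕ∞} (hf : ContDiffOn ℝ n f closedUpperHalf)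
    (hmn : m + 1 ≤ n) : ContDiffOn ℝ m (pd2 f) closedUpperHalf :=
  ((hf.fderivWithin uniqueDiffOn_closedUpperHalf hmn).clm_apply contDiffOn_const).congr
    (pd2_eq_fderivWithin_s11 ((hf.of_le hmn).differentiableOn (by simp)))

end Partial

section ExpIntegral

variable {ν : ℝ} {f g : ℝ × ℝ → ℂ}

lemma continuousOn_snd_slice (hf : ContinuousOn f closedUpperHalf) (x : ℝ) :
    ContinuousOn (fun t => f (x, t)) (Ici 0) :=
  hf.comp (by fun_prop) (fun _ ht => ht)

lemma continuousOn_snd_slice_mul_exp (hf : ContinuousOn f closedUpperHalf) (x : ℝ) :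
    ContinuousOn (fun t : ℝ => f (x, t) * Complex.exp (-(ν : ℂ) * t)) (Ici 0) :=
  (continuousOn_snd_slice hf x).mul (by fun_prop)

lemma aestronglyMeasurable_mul_exp (hf : ContinuousOn f closedUpperHalf) (x : ℝ) :
    AEStronglyMeasurable (fun t : ℝ => f (x, t) * Complex.exp (-(ν : ℂ) * t))
      (volume.restrict (Ioi 0)) :=
  ((continuousOn_snd_slice_mul_exp hf x).mono Ioi_subset_Ici_self).aestronglyMeasurable
    measurableSet_Ioi

lemma norm_mul_exp_le {z : ℂ} {C γ t : ℝ} (h : ‖z‖ ≤ C * Real.exp (γ * t)) :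
    ‖z * Complex.exp (-(ν : ℂ) * t)‖ ≤ C * Real.exp (-(ν - γ) * t) := by
  have he : ‖Complex.exp (-(ν : ℂ) * t)‖ = Real.exp (-ν * t) := by
    simp [Complex.norm_exp]
  calc ‖z * Complex.exp (-(ν : ℂ) * t)‖ = ‖z‖ * Real.exp (-ν * t) := by rw [norm_mul, he]
    _ ≤ C * Real.exp (γ * t) * Real.exp (-ν * t) := by gcongr
    _ = C * Real.exp (-(ν - γ) * t) := by
      rw [mul_assoc, ← Real.exp_add]; ring_nf

lemma integrableOn_const_mul_exp {C γ : ℝ} (hγ : γ < ν) :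
    IntegrableOn (fun t : ℝ => C * Real.exp (-(ν - γ) * t)) (Ioi 0) :=
  (integrableOn_exp_mul_Ioi (by linarith) 0).const_mul C

lemma LocallyExpBounded.integrableOn (hb : LocallyExpBounded ν f)
    (hf : ContinuousOn f closedUpperHalf) (x : ℝ) :
    IntegrableOn (fun t : ℝ => f (x, t) * Complex.exp (-(ν : ℂ) * t)) (Ioi 0) := by
  obtain ⟨C, γ, hγ, h⟩ := hb {x} isCompact_singleton
  refine (integrableOn_const_mul_exp (C := C) hγ).mono' (aestronglyMeasurable_mul_exp hf x) ?_
  filter_upwards [ae_restrict_mem measurableSet_Ioi] with t ht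
  exact norm_mul_exp_le (h x rfl t (le_of_lt ht))

lemma LocallyExpBounded.tendsto_zero (hb : LocallyExpBounded ν f) (x : ℝ) :
    Filter.Tendsto (fun t : ℝ => f (x, t) * Complex.exp (-(ν : ℂ) * t)) Filter.atTop
      (nhds 0) := by
  obtain ⟨C, γ, hγ, h⟩ := hb {x} isCompact_singleton
  have hlim : Filter.Tendsto (fun t : ℝ => C * Real.exp (-(ν - γ) * t)) Filter.atTop
      (nhds 0) := by
    have := Real.tendsto_exp_atBot.comp
      (Filter.tendsto_id.const_mul_atTop_of_neg (show -(ν - γ) < 0 by linarith))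
    simpa using this.const_mul C
  refine squeeze_zero_norm' ?_ hlim
  filter_upwards [Filter.eventually_ge_atTop 0] with t ht
  exact norm_mul_exp_le (h x rfl t ht)

lemma LocallyExpBounded.continuous_expIntegral (hb : LocallyExpBounded ν f)
    (hf : ContinuousOn f closedUpperHalf) : Continuous (expIntegral ν f) := by
  refine continuous_iff_continuousAt.2 fun x => ?_
  obtain ⟨C, γ, hγ, h⟩ := hb _ (isCompact_closedBall x 1)
  refine continuousAt_of_dominated (bound := fun t => C * Real.exp (-(ν - γ) * t))
    (.of_forall fun y => aestronglyMeasurable_mul_exp hf y) ?_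
    (integrableOn_const_mul_exp hγ) ?_
  · filter_upwards [Metric.closedBall_mem_nhds x one_pos] with y hy
    filter_upwards [ae_restrict_mem measurableSet_Ioi] with t ht
    exact norm_mul_exp_le (h y hy t (le_of_lt ht))
  · filter_upwards [ae_restrict_mem measurableSet_Ioi] with t ht
    have hc : Continuous fun y => f (y, t) :=
      hf.comp_continuous (by fun_prop) (fun _ => (mem_Ioi.1 ht).le)
    exact (hc.mul continuous_const).continuousAt

lemma hasDerivAt_expIntegral (hf : ContDiffOn ℝ 1 f closedUpperHalf)
    (hb : LocallyExpBounded ν f) (hb' : LocallyExpBounded ν (pd1 f)) (x : ℝ) :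
    HasDerivAt (expIntegral ν f) (expIntegral ν (pd1 f) x) x := by
  obtain ⟨C, γ, hγ, h⟩ := hb' _ (isCompact_closedBall x 1)
  have hf' : ContinuousOn (pd1 f) closedUpperHalf := (hf.pd1 (m := 0) (by simp)).continuousOn
  refine (hasDerivAt_integral_of_dominated_loc_of_deriv_le
    (bound := fun t => C * Real.exp (-(ν - γ) * t))
    (F := fun y t => f (y, t) * Complex.exp (-(ν : ℂ) * t))
    (F' := fun y t => pd1 f (y, t) * Complex.exp (-(ν : ℂ) * t))
    (Metric.closedBall_mem_nhds x one_pos)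
    (.of_forall fun y => aestronglyMeasurable_mul_exp hf.continuousOn y)
    (hb.integrableOn hf.continuousOn x) (aestronglyMeasurable_mul_exp hf' x) ?_
    (integrableOn_const_mul_exp hγ) ?_).2
  · filter_upwards [ae_restrict_mem measurableSet_Ioi] with t ht y hy
    exact norm_mul_exp_le (h y hy t (le_of_lt ht))
  · filter_upwards [ae_restrict_mem measurableSet_Ioi] with t ht y _
    exact (hasDerivAt_pd1_s11 (hf.differentiableOn (by simp)) y (le_of_lt ht)).mul_const _

lemma expIntegral_pd2_pd2 (hf : ContDiffOn ℝ 2 f closedUpperHalf)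
    (hb : LocallyExpBounded ν f) (hb₂ : LocallyExpBounded ν (pd2 f))
    (hb₂₂ : LocallyExpBounded ν (pd2 (pd2 f))) {x : ℝ} (hbc : -pd2 f (x, 0) = ν * f (x, 0)) :
    expIntegral ν (pd2 (pd2 f)) x = (ν : ℂ) ^ 2 * expIntegral ν f x := by
  have hf₂ : ContDiffOn ℝ 1 (pd2 f) closedUpperHalf := hf.pd2 (by norm_num)
  have hf₂₂ : ContinuousOn (pd2 (pd2 f)) closedUpperHalf :=
    (hf₂.pd2 (m := 0) (by simp)).continuousOn
  have hint := (hb.integrableOn hf.continuousOn x).const_mul ((ν : ℂ) ^ 2)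
  have hint₂₂ := hb₂₂.integrableOn hf₂₂ x
  have hderiv : ∀ t ∈ Ioi (0 : ℝ), HasDerivAt
      (fun t : ℝ => pd2 f (x, t) * Complex.exp (-(ν : ℂ) * t)
        + ν * (f (x, t) * Complex.exp (-(ν : ℂ) * t)))
      (pd2 (pd2 f) (x, t) * Complex.exp (-(ν : ℂ) * t)
        - (ν : ℂ) ^ 2 * (f (x, t) * Complex.exp (-(ν : ℂ) * t))) t := by
    intro t ht
    have he : HasDerivAt (fun t : ℝ => Complex.exp (-(ν : ℂ) * t))
        (Complex.exp (-(ν : ℂ) * t) * (-(ν : ℂ) * 1)) t :=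
      ((Complex.ofRealCLM.hasDerivAt (x := t)).const_mul (-(ν : ℂ))).cexp
    have h1 := hasDerivAt_pd2_s11 (hf.differentiableOn (by simp)) x ht
    have h2 := hasDerivAt_pd2_s11 (hf₂.differentiableOn (by simp)) x ht
    refine ((h2.mul he).add ((h1.mul he).const_mul (ν : ℂ))).congr_deriv ?_
    ring
  have hcont : ContinuousWithinAt
      (fun t : ℝ => pd2 f (x, t) * Complex.exp (-(ν : ℂ) * t)
        + ν * (f (x, t) * Complex.exp (-(ν : ℂ) * t))) (Ici 0) 0 :=
    ((continuousOn_snd_slice_mul_exp hf₂.continuousOn x).add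
      ((continuousOn_snd_slice_mul_exp hf.continuousOn x).const_mul _)) 0 self_mem_Ici
  have hlim := (hb₂.tendsto_zero x).add ((hb.tendsto_zero x).const_mul (ν : ℂ))
  have key := integral_Ioi_of_hasDerivAt_of_tendsto hcont hderiv (hint₂₂.sub hint) hlim
  rw [integral_sub hint₂₂ hint, integral_const_mul] at key
  have hz : (0 : ℂ) + ν * 0 - (pd2 f (x, 0) * Complex.exp (-(ν : ℂ) * (0 : ℝ))
      + ν * (f (x, 0) * Complex.exp (-(ν : ℂ) * (0 : ℝ)))) = 0 := by
    simp only [Complex.ofReal_zero, mul_zero, Complex.exp_zero, mul_one, ← hbc]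
    ring
  exact sub_eq_zero.1 (key.trans hz)

end ExpIntegral

/-- The projection onto the profile `e^{−νx₂}` intertwines the Laplacian with
`d²/dx₁² + ν²` for functions satisfying the free-surface condition `−∂₂u(x₁,0) = νu(x₁,0)`:
if `w(x₁) = 2ν ∫₀^∞ u(x₁,x₂)e^{−νx₂} dx₂`, then `w` is `C²` and
`w″ + ν²w = 2ν ∫₀^∞ (Δu)e^{−νx₂} dx₂`; in particular if `Δu − iεu = F` on `{x₂ > 0}`,
then `w″ + (ν² − iε)w = 2ν ∫₀^∞ F e^{−νx₂} dx₂`. -/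
theorem projection_intertwines (ν : ℝ) (hν : 0 < ν) (u : ℝ × ℝ → ℂ)
    (hu : ContDiffOn ℝ 2 u {p : ℝ × ℝ | 0 ≤ p.2})
    (hgrowth : ∀ K : Set ℝ, IsCompact K → ∃ C : ℝ, 0 < C ∧ ∃ γ : ℝ, γ < ν ∧
      ∀ x₁ ∈ K, ∀ x₂ : ℝ, 0 ≤ x₂ →
        ‖u (x₁, x₂)‖ + ‖pd1 u (x₁, x₂)‖ + ‖pd1 (pd1 u) (x₁, x₂)‖
          + ‖pd2 u (x₁, x₂)‖ + ‖pd2 (pd2 u) (x₁, x₂)‖ ≤ C * Real.exp (γ * x₂))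
    (hbc : ∀ x₁ : ℝ, -pd2 u (x₁, 0) = ν * u (x₁, 0))
    (w : ℝ → ℂ)
    (hwdef : ∀ x₁ : ℝ,
      w x₁ = 2 * (ν : ℂ) * ∫ t in Ioi (0 : ℝ), u (x₁, t) * Complex.exp (-(ν : ℂ) * t)) :
    ContDiff ℝ 2 w ∧
    (∀ x₁ : ℝ, deriv (deriv w) x₁ + (ν : ℂ) ^ 2 * w x₁ =
      2 * (ν : ℂ) * ∫ t in Ioi (0 : ℝ),
        (pd1 (pd1 u) (x₁, t) + pd2 (pd2 u) (x₁, t)) * Complex.exp (-(ν : ℂ) * t)) ∧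
    (∀ (ε : ℝ) (F : ℝ × ℝ → ℂ),
      (∀ p ∈ upperHalf, pd1 (pd1 u) p + pd2 (pd2 u) p - Complex.I * ε * u p = F p) →
      ∀ x₁ : ℝ, deriv (deriv w) x₁ + ((ν : ℂ) ^ 2 - Complex.I * ε) * w x₁ =
        2 * (ν : ℂ) * ∫ t in Ioi (0 : ℝ), F (x₁, t) * Complex.exp (-(ν : ℂ) * t)) := by
  change ContDiffOn ℝ 2 u closedUpperHalf at hu
  have hbound : ∀ g : ℝ × ℝ → ℂ, (∀ p, ‖g p‖ ≤ ‖u p‖ + ‖pd1 u p‖ + ‖pd1 (pd1 u) p‖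
      + ‖pd2 u p‖ + ‖pd2 (pd2 u) p‖) → LocallyExpBounded ν g := by
    intro g hg K hK
    obtain ⟨C, -, γ, hγ, h⟩ := hgrowth K hK
    exact ⟨C, γ, hγ, fun x hx t ht => (hg _).trans (h x hx t ht)⟩
  have hb := hbound u fun p => by
    linarith [norm_nonneg (pd1 u p),
      norm_nonneg (pd1 (pd1 u) p), norm_nonneg (pd2 u p), norm_nonneg (pd2 (pd2 u) p)]
  have hb₁ := hbound (pd1 u) fun p => by
    linarith [norm_nonneg (u p),
      norm_nonneg (pd1 (pd1 u) p), norm_nonneg (pd2 u p), norm_nonneg (pd2 (pd2 u) p)]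
  have hb₁₁ := hbound (pd1 (pd1 u)) fun p => by
    linarith [norm_nonneg (u p),
      norm_nonneg (pd1 u p), norm_nonneg (pd2 u p), norm_nonneg (pd2 (pd2 u) p)]
  have hb₂ := hbound (pd2 u) fun p => by
    linarith [norm_nonneg (u p),
      norm_nonneg (pd1 u p), norm_nonneg (pd1 (pd1 u) p), norm_nonneg (pd2 (pd2 u) p)]
  have hb₂₂ := hbound (pd2 (pd2 u)) fun p => by
    linarith [norm_nonneg (u p),
      norm_nonneg (pd1 u p), norm_nonneg (pd1 (pd1 u) p), norm_nonneg (pd2 u p)]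
  have hu₁ : ContDiffOn ℝ 1 (pd1 u) closedUpperHalf := hu.pd1 (by norm_num)
  have hu₂ : ContDiffOn ℝ 1 (pd2 u) closedUpperHalf := hu.pd2 (by norm_num)
  have hu₁₁ := (hu₁.pd1 (m := 0) (by simp)).continuousOn
  have hu₂₂ := (hu₂.pd2 (m := 0) (by simp)).continuousOn
  have hw : w = fun x => 2 * (ν : ℂ) * expIntegral ν u x := funext hwdef
  have hd : ∀ x, HasDerivAt w (2 * (ν : ℂ) * expIntegral ν (pd1 u) x) x := fun x =>
    hw ▸ (hasDerivAt_expIntegral (hu.of_le (by norm_num)) hb hb₁ x).const_mul _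
  have hdw : deriv w = fun x => 2 * (ν : ℂ) * expIntegral ν (pd1 u) x :=
    funext fun x => (hd x).deriv
  have hdd : ∀ x, HasDerivAt (deriv w) (2 * (ν : ℂ) * expIntegral ν (pd1 (pd1 u)) x) x :=
    fun x => hdw ▸ (hasDerivAt_expIntegral hu₁ hb₁ hb₁₁ x).const_mul _
  have hddw : deriv (deriv w) = fun x => 2 * (ν : ℂ) * expIntegral ν (pd1 (pd1 u)) x :=
    funext fun x => (hdd x).deriv
  have hmain : ∀ x₁ : ℝ, deriv (deriv w) x₁ + (ν : ℂ) ^ 2 * w x₁ =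
      2 * (ν : ℂ) * ∫ t in Ioi (0 : ℝ),
        (pd1 (pd1 u) (x₁, t) + pd2 (pd2 u) (x₁, t)) * Complex.exp (-(ν : ℂ) * t) := by
    intro x
    have hadd := integral_add (hb₁₁.integrableOn hu₁₁ x) (hb₂₂.integrableOn hu₂₂ x)
    have hparts := expIntegral_pd2_pd2 hu hb hb₂ hb₂₂ (hbc x)
    simp only [add_mul]
    rw [hadd, hddw, hw]
    unfold expIntegral at *
    rw [hparts]
    ring
  refine ⟨?_, hmain, ?_⟩
  · rw [show (2 : WithTop ℕ∞) = 1 + 1 by norm_num, contDiff_succ_iff_deriv]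
    refine ⟨fun x => (hd x).differentiableAt, by simp, ?_⟩
    rw [contDiff_one_iff_deriv, hddw]
    exact ⟨fun x => (hdd x).differentiableAt,
      continuous_const.mul (hb₁₁.continuous_expIntegral hu₁₁)⟩
  · intro ε F hF x
    have hint : IntegrableOn (fun t : ℝ => (pd1 (pd1 u) (x, t) + pd2 (pd2 u) (x, t)) *
        Complex.exp (-(ν : ℂ) * t)) (Ioi 0) := by
      simp only [add_mul]
      exact (hb₁₁.integrableOn hu₁₁ x).add (hb₂₂.integrableOn hu₂₂ x)
    have hsub := integral_sub hint
      ((hb.integrableOn hu.continuousOn x).const_mul (Complex.I * ε))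
    have hFint : ∫ t in Ioi (0 : ℝ), F (x, t) * Complex.exp (-(ν : ℂ) * t) =
        ∫ t in Ioi (0 : ℝ), ((pd1 (pd1 u) (x, t) + pd2 (pd2 u) (x, t)) *
          Complex.exp (-(ν : ℂ) * t)
          - Complex.I * ε * (u (x, t) * Complex.exp (-(ν : ℂ) * t))) := by
      refine setIntegral_congr_fun measurableSet_Ioi fun t ht => ?_
      simp only [← hF (x, t) ht]
      ring
    rw [hFint, hsub, integral_const_mul, mul_sub, ← hmain x, hwdef x]
    ring
end

section
/- Let ν > 0 and let u : ℝ × [0,∞) → ℂ be twice continuously differentiable with Δu = 0 in {x₂ > 0} and −∂_{x₂}u(x₁,0) = ν u(x₁,0) for every x₁ ∈ ℝ. Suppose that u and ∇u are bounded on ℝ × [0,∞). Then there exist constants c₁, c₂ ∈ ℂ such that u(x₁,x₂) = c₁ e^{−iνx₁ − νx₂} + c₂ e^{iνx₁ − νx₂} for all (x₁,x₂). -/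
open Set MeasureTheory

/-- A function holomorphic on the closed right half-plane whose real part is bounded above there and
vanishes on the imaginary axis has nonpositive real part. -/
lemma re_nonpos_of_differentiableOn_rightHalfPlane {H : ℂ → ℂ} {C : ℝ}
    (hH : DifferentiableOn ℂ H {z | 0 ≤ z.re}) (hC : ∀ z : ℂ, 0 ≤ z.re → (H z).re ≤ C)
    (h0 : ∀ z : ℂ, z.re = 0 → (H z).re = 0) {z : ℂ} (hz : 0 ≤ z.re) : (H z).re ≤ 0 := by
  have hd : DiffContOnCl ℂ (fun z => Complex.exp (H z)) {z | 0 < z.re} := by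
    apply DifferentiableOn.diffContOnCl
    rw [Complex.closure_setOfPred_lt_re]
    exact hH.cexp
  have hnorm : ‖Complex.exp (H z)‖ ≤ 1 := by
    refine PhragmenLindelof.right_half_plane_of_bounded_on_real
      (f := fun z => Complex.exp (H z)) hd ⟨1, by norm_num, 0, ?_⟩ ?_ ?_ hz
    · refine Asymptotics.IsBigO.of_bound (Real.exp C) ?_
      refine Filter.Eventually.filter_mono inf_le_right ?_
      refine Filter.eventually_principal.2 fun w (hw : 0 < w.re) => ?_
      simpa [Complex.norm_exp] using hC w hw.le
    · refine Filter.isBoundedUnder_of_eventually_le (a := Real.exp C) ?_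
      filter_upwards [Filter.eventually_ge_atTop (0 : ℝ)] with x hx
      simpa [Complex.norm_exp] using hC x (by simpa using hx)
    · intro x
      simp [Complex.norm_exp, h0 (x * Complex.I) (by simp)]
  simpa [Complex.norm_exp] using hnorm

/-- A bounded harmonic function on the closed right half-plane which satisfies the Robin condition
`∂₁g + νg = 0` on the imaginary axis and has bounded normal derivative satisfies it everywhere. -/
lemma robin_eq_zero_of_harmonic_rightHalfPlane {g a b : ℂ → ℝ} {a' b' : ℂ → ℂ →L[ℝ] ℝ} {ν C : ℝ}
    (hg : ∀ z : ℂ, 0 ≤ z.re → HasFDerivWithinAt g (b z • Complex.reCLM + a z • Complex.imCLM)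
      {z | 0 ≤ z.re} z)
    (ha : ∀ z : ℂ, 0 ≤ z.re → HasFDerivWithinAt a (a' z) {z | 0 ≤ z.re} z)
    (hb : ∀ z : ℂ, 0 ≤ z.re → HasFDerivWithinAt b (b' z) {z | 0 ≤ z.re} z)
    (hsymm : ∀ z : ℂ, 0 ≤ z.re → a' z 1 = b' z Complex.I)
    (hlap : ∀ z : ℂ, 0 ≤ z.re → a' z Complex.I + b' z 1 = 0)
    (hbdd : ∀ z : ℂ, 0 ≤ z.re → |b z + ν * g z| ≤ C)
    (hbc : ∀ z : ℂ, z.re = 0 → b z + ν * g z = 0) {z : ℂ} (hz : 0 ≤ z.re) :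
    b z + ν * g z = 0 := by
  have hconv : Convex ℝ {z : ℂ | 0 ≤ z.re} := convex_halfSpace_re_ge 0
  set F : ℂ → ℂ := fun z => (b z : ℂ) - Complex.I * (a z : ℂ) with hF
  have hFd : DifferentiableOn ℂ F {z | 0 ≤ z.re} := by
    intro w hw
    have h1 : HasFDerivWithinAt F (Complex.ofRealCLM ∘L b' w -
        Complex.I • (Complex.ofRealCLM ∘L a' w)) {z | 0 ≤ z.re} w :=
      (Complex.ofRealCLM.hasFDerivAt.comp_hasFDerivWithinAt w (hb w hw)).sub
        ((Complex.ofRealCLM.hasFDerivAt.comp_hasFDerivWithinAt w (ha w hw)).const_smul Complex.I)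
    refine (h1.complexOfReal ?_).differentiableWithinAt
    have e1 := hsymm w hw
    have e2 : a' w Complex.I = - b' w 1 := by linarith [hlap w hw]
    apply Complex.ext <;> simp [e1, e2]
  obtain ⟨G, hG⟩ := hconv.exists_forall_hasDerivWithinAt hFd
  have hunique : UniqueDiffOn ℝ {z : ℂ | 0 ≤ z.re} := by
    refine uniqueDiffOn_convex hconv ⟨1, ?_⟩
    rw [Complex.interior_setOfPred_le_re]
    simp
  have hdiff : ∀ w : ℂ, 0 ≤ w.re →
      HasFDerivWithinAt (fun z => g z - (G z).re) (0 : ℂ →L[ℝ] ℝ) {z | 0 ≤ z.re} w := by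
    intro w hw
    have h1 := (hg w hw).sub (Complex.reCLM.hasFDerivAt.comp_hasFDerivWithinAt w
      ((hG w hw).hasFDerivWithinAt.restrictScalars ℝ))
    refine h1.congr_fderiv ?_
    ext v
    simp [hF]
    ring
  have hconst : ∀ w : ℂ, 0 ≤ w.re → g w - (G w).re = g 0 - (G 0).re := fun w hw =>
    hconv.is_const_of_fderivWithin_eq_zero (fun x hx => (hdiff x hx).differentiableWithinAt)
      (fun x hx => (hdiff x hx).fderivWithin (hunique x hx)) hw (by simp)
  set H : ℂ → ℂ := fun z => F z + ν * (G z + ((g 0 - (G 0).re : ℝ) : ℂ)) with hH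
  have hHd : DifferentiableOn ℂ H {z | 0 ≤ z.re} :=
    hFd.add (((DifferentiableOn.add_const _
      fun w hw => (hG w hw).differentiableWithinAt)).const_mul _)
  have hre : ∀ w : ℂ, 0 ≤ w.re → (H w).re = b w + ν * g w := by
    intro w hw
    have : g w = (G w).re + (g 0 - (G 0).re) := by linarith [hconst w hw]
    rw [this]
    simp [hH, hF]
  have hle := re_nonpos_of_differentiableOn_rightHalfPlane (C := C) hHd
    (fun w hw => by rw [hre w hw]; exact (abs_le.1 (hbdd w hw)).2)
    (fun w hw => by rw [hre w hw.ge, hbc w hw]) hz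
  have hge := re_nonpos_of_differentiableOn_rightHalfPlane (C := C) hHd.neg
    (fun w hw => by
      simp only [Pi.neg_apply, Complex.neg_re]
      rw [hre w hw]; linarith [(abs_le.1 (hbdd w hw)).1])
    (fun w hw => by simp [hre w hw.ge, hbc w hw]) hz
  rw [Pi.neg_apply, Complex.neg_re, hre z hz] at hge
  rw [hre z hz] at hle
  linarith

lemma uniqueDiffOn_closedHalfPlane : UniqueDiffOn ℝ {p : ℝ × ℝ | 0 ≤ p.2} := by
  have : {p : ℝ × ℝ | 0 ≤ p.2} = univ ×ˢ Ici 0 := by ext; simp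
  rw [this]
  exact uniqueDiffOn_univ.prod (uniqueDiffOn_Ici 0)

lemma closure_upperHalf : closure upperHalf = {p : ℝ × ℝ | 0 ≤ p.2} := by
  have h1 : upperHalf = univ ×ˢ Ioi 0 := by ext; simp [upperHalf]
  rw [h1, closure_prod_eq, closure_univ, closure_Ioi]
  ext; simp

lemma upperHalf_subset : upperHalf ⊆ {p : ℝ × ℝ | 0 ≤ p.2} :=
  closure_upperHalf ▸ subset_closure

lemma pd1_eq_of_hasFDerivWithinAt {f : ℝ × ℝ → ℂ} {f' : ℝ × ℝ →L[ℝ] ℂ} {p : ℝ × ℝ}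
    (hp : 0 ≤ p.2) (hf : HasFDerivWithinAt f f' {p | 0 ≤ p.2} p) : pd1 f p = f' (1, 0) := by
  have h1 : HasDerivAt (fun s : ℝ => (s, p.2)) (1, 0) p.1 :=
    (hasDerivAt_id p.1).prodMk (hasDerivAt_const _ _)
  have h2 := hf.comp_hasDerivWithinAt (s := univ) p.1 h1.hasDerivWithinAt fun _ _ => hp
  exact (hasDerivWithinAt_univ.1 h2).deriv

lemma pd2_eq_of_hasFDerivWithinAt {f : ℝ × ℝ → ℂ} {f' : ℝ × ℝ →L[ℝ] ℂ} {p : ℝ × ℝ}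
    (hp : 0 ≤ p.2) (hf : HasFDerivWithinAt f f' {p | 0 ≤ p.2} p) : pd2 f p = f' (0, 1) := by
  have h1 : HasDerivAt (fun t : ℝ => (p.1, t)) (0, 1) p.2 :=
    (hasDerivAt_const _ _).prodMk (hasDerivAt_id p.2)
  have h2 := hf.comp_hasDerivWithinAt (s := Ici 0) p.2 h1.hasDerivWithinAt fun _ ht => ht
  exact h2.derivWithin (uniqueDiffOn_Ici 0 _ hp)

/-- The first and second derivatives of a `C²` function on the closed half-plane which is harmonic
in the open half-plane, in terms of its partial derivatives. -/
lemma exists_hasFDerivWithinAt_pd {u : ℝ × ℝ → ℂ}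
    (hu : ContDiffOn ℝ 2 u {p : ℝ × ℝ | 0 ≤ p.2})
    (hharm : ∀ p ∈ upperHalf, pd1 (pd1 u) p + pd2 (pd2 u) p = 0) :
    ∃ A P Q : ℝ × ℝ → ℝ × ℝ →L[ℝ] ℂ, ∀ p : ℝ × ℝ, 0 ≤ p.2 →
      HasFDerivWithinAt u (A p) {p | 0 ≤ p.2} p ∧
      HasFDerivWithinAt (pd1 u) (P p) {p | 0 ≤ p.2} p ∧
      HasFDerivWithinAt (pd2 u) (Q p) {p | 0 ≤ p.2} p ∧
      A p (1, 0) = pd1 u p ∧ A p (0, 1) = pd2 u p ∧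
      P p (0, 1) = Q p (1, 0) ∧ P p (1, 0) + Q p (0, 1) = 0 := by
  set T : Set (ℝ × ℝ) := {p | 0 ≤ p.2} with hT
  have hun : UniqueDiffOn ℝ T := uniqueDiffOn_closedHalfPlane
  set A := fderivWithin ℝ u T with hA
  have hAd : ContDiffOn ℝ 1 A T := hu.fderivWithin hun (by norm_num)
  set D := fderivWithin ℝ A T with hD
  have hDc : ContinuousOn D T := hAd.continuousOn_fderivWithin hun le_rfl
  have hu' : ∀ p ∈ T, HasFDerivWithinAt u (A p) T p := fun p hp =>
    (hu.differentiableOn (by norm_num) p hp).hasFDerivWithinAt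
  have hA' : ∀ p ∈ T, HasFDerivWithinAt A (D p) T p := fun p hp =>
    (hAd.differentiableOn (by norm_num) p hp).hasFDerivWithinAt
  have h1 : ∀ p ∈ T, pd1 u p = A p (1, 0) := fun p hp => pd1_eq_of_hasFDerivWithinAt hp (hu' p hp)
  have h2 : ∀ p ∈ T, pd2 u p = A p (0, 1) := fun p hp => pd2_eq_of_hasFDerivWithinAt hp (hu' p hp)
  have hP : ∀ p ∈ T, HasFDerivWithinAt (pd1 u) ((D p).flip (1, 0)) T p := fun p hp =>
    (((hA' p hp).clm_apply (hasFDerivWithinAt_const (1, 0) p T)).congr h1 (h1 p hp)).congr_fderiv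
      (by ext <;> simp)
  have hQ : ∀ p ∈ T, HasFDerivWithinAt (pd2 u) ((D p).flip (0, 1)) T p := fun p hp =>
    (((hA' p hp).clm_apply (hasFDerivWithinAt_const (0, 1) p T)).congr h2 (h2 p hp)).congr_fderiv
      (by ext <;> simp)
  have hlap : EqOn (fun p => D p (1, 0) (1, 0) + D p (0, 1) (0, 1)) 0 T := by
    refine EqOn.of_subset_closure (s := upperHalf) (fun p hp => ?_) ?_ continuousOn_const
      upperHalf_subset closure_upperHalf.ge
    · have hp' : p ∈ T := upperHalf_subset hp
      have := hharm p hp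
      rwa [pd1_eq_of_hasFDerivWithinAt hp' (hP p hp'),
        pd2_eq_of_hasFDerivWithinAt hp' (hQ p hp')] at this
    · fun_prop
  refine ⟨A, fun p => (D p).flip (1, 0), fun p => (D p).flip (0, 1), fun p hp =>
    ⟨hu' p hp, hP p hp, hQ p hp, (h1 p hp).symm, (h2 p hp).symm, ?_, hlap hp⟩⟩
  have hclos : p ∈ closure (interior T) := by
    have : p ∈ closure upperHalf := closure_upperHalf.ge hp
    exact closure_mono (interior_maximal upperHalf_subset isOpen_upperHalf) this
  exact (hu p hp).isSymmSndFDerivWithinAt (by simp) hun hclos hp (0, 1) (1, 0)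

/-- A bounded solution of the water-wave problem with bounded gradient satisfies `∂₂u = -νu`
throughout the half-plane. -/
lemma pd2_eq_neg_mul_of_waterWave {ν : ℝ} {u : ℝ × ℝ → ℂ}
    (hu : ContDiffOn ℝ 2 u {p : ℝ × ℝ | 0 ≤ p.2})
    (hharm : ∀ p ∈ upperHalf, pd1 (pd1 u) p + pd2 (pd2 u) p = 0)
    (hbc : ∀ x₁ : ℝ, -pd2 u (x₁, 0) = ν * u (x₁, 0))
    (hbdd : ∃ M : ℝ, ∀ p : ℝ × ℝ, 0 ≤ p.2 → ‖u p‖ + ‖pd1 u p‖ + ‖pd2 u p‖ ≤ M)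
    {p : ℝ × ℝ} (hp : 0 ≤ p.2) : pd2 u p = -(ν * u p) := by
  obtain ⟨A, P, Q, h⟩ := exists_hasFDerivWithinAt_pd hu hharm
  obtain ⟨M, hM⟩ := hbdd
  set e : ℂ →L[ℝ] ℝ × ℝ := Complex.imCLM.prod Complex.reCLM with he
  have he' : ∀ z : ℂ, HasFDerivWithinAt (fun z : ℂ => (z.im, z.re)) e {z | 0 ≤ z.re} z :=
    fun z => e.hasFDerivWithinAt
  have key : ∀ L : ℂ →L[ℝ] ℝ, ∀ z : ℂ, 0 ≤ z.re →
      L (pd2 u (z.im, z.re)) + ν * L (u (z.im, z.re)) = 0 := by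
    intro L z hz
    have hlift : ∀ {f : ℝ × ℝ → ℂ} {f' : ℝ × ℝ →L[ℝ] ℂ} {z : ℂ},
        HasFDerivWithinAt f f' {p | 0 ≤ p.2} (z.im, z.re) →
        HasFDerivWithinAt (fun z : ℂ => L (f (z.im, z.re))) (L ∘L f' ∘L e) {z | 0 ≤ z.re} z :=
      fun {f f' z} hf => L.hasFDerivAt.comp_hasFDerivWithinAt z
        (hf.comp z (he' z) fun w hw => hw)
    have hmul : ∀ w : ℂ, L (ν * w) = ν * L w := fun w => by
      rw [← Complex.real_smul, map_smul, smul_eq_mul]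
    refine robin_eq_zero_of_harmonic_rightHalfPlane (g := fun z => L (u (z.im, z.re)))
      (a := fun z => L (pd1 u (z.im, z.re))) (b := fun z => L (pd2 u (z.im, z.re)))
      (a' := fun z => L ∘L P (z.im, z.re) ∘L e) (b' := fun z => L ∘L Q (z.im, z.re) ∘L e)
      (C := ‖L‖ * (M + |ν| * M)) ?_ ?_ ?_ ?_ ?_ ?_ ?_ hz
    · intro w hw
      obtain ⟨h1, -, -, h4, h5, -⟩ := h (w.im, w.re) hw
      refine (hlift h1).congr_fderiv ?_
      rw [← h4, ← h5]
      ext v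
      have : ((v.im, v.re) : ℝ × ℝ) = v.re • ((0, 1) : ℝ × ℝ) + v.im • ((1, 0) : ℝ × ℝ) := by
        simp
      simp only [he, ContinuousLinearMap.comp_apply, ContinuousLinearMap.prod_apply,
        Complex.imCLM_apply, Complex.reCLM_apply, this, map_add, map_smul,
        add_apply, smul_apply, smul_eq_mul]
      ring
    · exact fun w hw => hlift (h (w.im, w.re) hw).2.1
    · exact fun w hw => hlift (h (w.im, w.re) hw).2.2.1
    · intro w hw
      simp [he, (h (w.im, w.re) hw).2.2.2.2.2.1]
    · intro w hw
      simp [he, ← map_add, (h (w.im, w.re) hw).2.2.2.2.2.2]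
    · intro w hw
      rw [← hmul, ← map_add]
      refine (L.le_opNorm _).trans (mul_le_mul_of_nonneg_left ?_ (norm_nonneg _))
      have hMw := hM (w.im, w.re) hw
      refine (norm_add_le _ _).trans (add_le_add ?_ ?_)
      · linarith [norm_nonneg (u (w.im, w.re)), norm_nonneg (pd1 u (w.im, w.re))]
      · rw [norm_mul, Complex.norm_real, Real.norm_eq_abs]
        refine mul_le_mul_of_nonneg_left ?_ (abs_nonneg _)
        linarith [norm_nonneg (pd2 u (w.im, w.re)), norm_nonneg (pd1 u (w.im, w.re))]
    · intro w hw
      simp only [hw]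
      rw [← hmul, ← map_add, ← hbc]
      simp
  have hz := fun L => key L ⟨p.2, p.1⟩ hp
  have h1 := hz Complex.reCLM
  have h2 := hz Complex.imCLM
  simp only [Complex.reCLM_apply, Complex.imCLM_apply] at h1 h2
  apply Complex.ext <;> simp <;> linarith

/-- Solutions of `φ'' = -ν²φ` on the line are combinations of `e^{±iνx}`. -/
lemma exists_eq_exp_of_hasDerivAt {ν : ℝ} (hν : ν ≠ 0) {φ ψ : ℝ → ℂ}
    (hφ : ∀ x, HasDerivAt φ (ψ x) x) (hψ : ∀ x, HasDerivAt ψ (-(ν ^ 2 * φ x)) x) :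
    ∃ k₁ k₂ : ℂ, ∀ x : ℝ, φ x = k₁ * Complex.exp (-Complex.I * ν * x)
      + k₂ * Complex.exp (Complex.I * ν * x) := by
  have hconst : ∀ c : ℂ, c ^ 2 = -ν ^ 2 → ∀ x : ℝ,
      (ψ x - c * φ x) * Complex.exp (c * x) = ψ 0 - c * φ 0 := by
    intro c hc x
    have hd : ∀ y : ℝ, HasDerivAt (fun x : ℝ => (ψ x - c * φ x) * Complex.exp (c * x)) 0 y := by
      intro y
      have he : HasDerivAt (fun x : ℝ => Complex.exp (c * x)) (Complex.exp (c * y) * (c * 1)) y :=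
        ((Complex.ofRealCLM.hasDerivAt (x := y)).const_mul c).cexp
      refine (((hψ y).sub ((hφ y).const_mul c)).mul he).congr_deriv ?_
      simp only [Pi.sub_apply]
      linear_combination -(φ y * Complex.exp (c * y)) * hc
    have := is_const_of_deriv_eq_zero (fun y => (hd y).differentiableAt) (fun y => (hd y).deriv) x 0
    simpa using this
  have hν' : (ν : ℂ) ≠ 0 := by exact_mod_cast hν
  refine ⟨-(ψ 0 - Complex.I * ν * φ 0) / (2 * Complex.I * ν),
    (ψ 0 - (-Complex.I * ν) * φ 0) / (2 * Complex.I * ν), fun x => ?_⟩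
  have h1 := hconst (Complex.I * ν) (by rw [mul_pow, Complex.I_sq]; ring) x
  have h2 := hconst (-Complex.I * ν) (by rw [mul_pow, neg_sq, Complex.I_sq]; ring) x
  rw [← h1, ← h2]
  have h3 : Complex.exp (Complex.I * ν * x) * Complex.exp (-Complex.I * ν * x) = 1 := by
    rw [← Complex.exp_add]; ring_nf; simp
  rw [div_mul_eq_mul_div, div_mul_eq_mul_div, ← add_div,
    eq_div_iff (by simp [hν', Complex.I_ne_zero])]
  linear_combination (-2 * Complex.I * ν * φ x) * h3

/-- Liouville-type classification of bounded solutions of the homogeneous water-wave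
problem in the half-plane: if `Δu = 0` in `{x₂ > 0}`, `−∂₂u(x₁,0) = νu(x₁,0)`, and `u`,
`∇u` are bounded, then `u(x₁,x₂) = c₁e^{−iνx₁−νx₂} + c₂e^{iνx₁−νx₂}`. -/
theorem liouville_water_waves (ν : ℝ) (hν : 0 < ν) (u : ℝ × ℝ → ℂ)
    (hu : ContDiffOn ℝ 2 u {p : ℝ × ℝ | 0 ≤ p.2})
    (hharm : ∀ p ∈ upperHalf, pd1 (pd1 u) p + pd2 (pd2 u) p = 0)
    (hbc : ∀ x₁ : ℝ, -pd2 u (x₁, 0) = ν * u (x₁, 0))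
    (hbdd : ∃ M : ℝ, ∀ p : ℝ × ℝ, 0 ≤ p.2 →
      ‖u p‖ + ‖pd1 u p‖ + ‖pd2 u p‖ ≤ M) :
    ∃ c₁ c₂ : ℂ, ∀ x₁ x₂ : ℝ, 0 ≤ x₂ →
      u (x₁, x₂) = c₁ * Complex.exp (-Complex.I * ν * x₁ - ν * x₂)
        + c₂ * Complex.exp (Complex.I * ν * x₁ - ν * x₂) := by
  have hpd2 : ∀ p : ℝ × ℝ, 0 ≤ p.2 → pd2 u p = -(ν * u p) := fun p hp =>
    pd2_eq_neg_mul_of_waterWave hu hharm hbc hbdd hp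
  obtain ⟨A, P, Q, h⟩ := exists_hasFDerivWithinAt_pd hu hharm
  have hvert : ∀ x t : ℝ, 0 ≤ t → u (x, t) * Complex.exp (ν * t) = u (x, 0) := by
    intro x t ht
    have hd : ∀ s ∈ Ici (0 : ℝ), HasDerivWithinAt
        (fun s : ℝ => u (x, s) * Complex.exp (ν * s)) 0 (Ici 0) s := by
      intro s hs
      obtain ⟨h1, -, -, -, h5, -⟩ := h (x, s) hs
      have hline : HasDerivAt (fun s : ℝ => (x, s)) (0, 1) s :=
        (hasDerivAt_const _ _).prodMk (hasDerivAt_id s)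
      have hu1 := h1.comp_hasDerivWithinAt (s := Ici 0) s hline.hasDerivWithinAt fun _ hr => hr
      have he : HasDerivAt (fun s : ℝ => Complex.exp (ν * s)) (Complex.exp (ν * s) * (ν * 1)) s :=
        ((Complex.ofRealCLM.hasDerivAt (x := s)).const_mul (ν : ℂ)).cexp
      refine (hu1.mul he.hasDerivWithinAt).congr_deriv ?_
      rw [h5, hpd2 (x, s) hs, Function.comp_apply]
      ring
    have := (convex_Ici (0 : ℝ)).is_const_of_fderivWithin_eq_zero (𝕜 := ℝ)
      (fun s hs => (hd s hs).differentiableWithinAt)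
      (fun s hs => by
        rw [(hd s hs).hasFDerivWithinAt.fderivWithin (uniqueDiffOn_Ici 0 s hs)]; ext; simp)
      ht (self_mem_Ici (a := (0 : ℝ)))
    simpa using this
  have hline : ∀ x : ℝ, HasDerivWithinAt (fun x : ℝ => (x, (0 : ℝ))) (1, 0) univ x := fun x =>
    ((hasDerivAt_id x).prodMk (hasDerivAt_const _ _)).hasDerivWithinAt
  obtain ⟨k₁, k₂, hk⟩ := exists_eq_exp_of_hasDerivAt hν.ne' (φ := fun x => u (x, 0))
    (ψ := fun x => pd1 u (x, 0))
    (fun x => by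
      obtain ⟨h1, -, -, h4, -⟩ := h (x, 0) le_rfl
      rw [← h4]
      exact hasDerivWithinAt_univ.1
        (h1.comp_hasDerivWithinAt x (hline x) fun _ _ => le_refl (0 : ℝ)))
    (fun x => by
      obtain ⟨h1, h2, h3, -, h5, -, h7⟩ := h (x, 0) le_rfl
      have hQ : Q (x, 0) (0, 1) = ν ^ 2 * u (x, 0) := by
        rw [← pd2_eq_of_hasFDerivWithinAt le_rfl h3, pd2_eq_of_hasFDerivWithinAt le_rfl
          ((h1.const_mul (ν : ℂ)).neg.congr hpd2 (hpd2 _ le_rfl))]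
        simp only [neg_apply, smul_apply, h5,
          hpd2 (x, 0) le_rfl, smul_eq_mul]
        ring
      rw [← hQ, ← eq_neg_of_add_eq_zero_left h7]
      exact hasDerivWithinAt_univ.1
        (HasFDerivWithinAt.comp_hasDerivWithinAt (f := fun x : ℝ => (x, (0 : ℝ))) x h2 (hline x)
          fun _ _ => le_refl (0 : ℝ)))
  refine ⟨k₁, k₂, fun x t ht => ?_⟩
  have hx := hvert x t ht
  rw [hk x] at hx
  rw [Complex.exp_sub, Complex.exp_sub, ← mul_div_assoc, ← mul_div_assoc, ← add_div,
    eq_div_iff (Complex.exp_ne_zero _), hx]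
end
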